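/- arXiv:1212.4187 — 2 statements merged into one kernel-verified Lean document; each statement's English description precedes it below -/
import Mathlib

section
/- Let ℱ = (F_n)_{n∈ℕ} be a left Følner sequence of nonempty finite subsets of ℚ (under addition), and let A ⊆ ℚ with d̄_ℱ(A) > 0. Then for each k ∈ ℕ there exist a nonzero rational number q and p ∈ A such that p + jq ∈ A for every 0 ≤ j ≤ k; that is, A contains arithmetic progressions of every finite length. -/
open scoped symmDiff

/-- `(F_n)` is a left Følner sequence of nonempty finite subsets of `ℚ`. -/
def IsLeftFolner (F : ℕ → Finset ℚ) : Prop :=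
  (∀ n, (F n).Nonempty) ∧
    ∀ s : ℚ, Filter.Tendsto
      (fun n => ((((F n).image (s + ·)) ∆ (F n)).card : ℝ) / (F n).card)
      Filter.atTop (nhds 0)

/-- The upper density `d̄_ℱ(A) = limsup_n |A ∩ F_n| / |F_n|`. -/
noncomputable def upperDensity (F : ℕ → Finset ℚ) (A : Set ℚ) : ℝ :=
  Filter.limsup (fun n => (Set.ncard (A ∩ ↑(F n)) : ℝ) / (F n).card) Filter.atTop


namespace DHJ
open Classical

noncomputable def av {X : Type*} [Finite X] (f : X → ℝ) : ℝ :=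
  (∑ x ∈ @Finset.univ X (Fintype.ofFinite X), f x) / Nat.card X

lemma av_eq {X : Type*} [Fintype X] (f : X → ℝ) : av f = (∑ x, f x) / Fintype.card X := by
  unfold av
  rw [Nat.card_eq_fintype_card]
  congr 2
  ext; simp

noncomputable def ind (p : Prop) : ℝ := if p then 1 else 0

lemma ind_nonneg (p : Prop) : 0 ≤ ind p := by unfold ind; split_ifs <;> norm_num
lemma ind_le_one (p : Prop) : ind p ≤ 1 := by unfold ind; split_ifs <;> norm_num
lemma ind_true {p : Prop} (h : p) : ind p = 1 := if_pos h
lemma ind_false {p : Prop} (h : ¬ p) : ind p = 0 := if_neg h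

noncomputable def mu {X : Type*} [Finite X] (A : Set X) : ℝ := av (fun x => ind (x ∈ A))

section av
variable {X Y : Type*} [Finite X] [Finite Y]

lemma av_mono {f g : X → ℝ} (h : ∀ x, f x ≤ g x) : av f ≤ av g := by
  unfold av; gcongr; exact h _

lemma av_add (f g : X → ℝ) : av (fun x => f x + g x) = av f + av g := by
  unfold av; rw [Finset.sum_add_distrib, add_div]

lemma av_sub (f g : X → ℝ) : av (fun x => f x - g x) = av f - av g := by
  unfold av; rw [Finset.sum_sub_distrib, sub_div]

lemma av_mul (c : ℝ) (f : X → ℝ) : av (fun x => c * f x) = c * av f := by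
  unfold av; rw [← Finset.mul_sum, mul_div_assoc]

lemma av_const [Nonempty X] (c : ℝ) : av (fun _ : X => c) = c := by
  have := Fintype.ofFinite X
  rw [av_eq]; simp

lemma av_nonneg {f : X → ℝ} (h : ∀ x, 0 ≤ f x) : 0 ≤ av f := by
  unfold av; exact div_nonneg (Finset.sum_nonneg fun x _ => h x) (by positivity)

lemma av_le [Nonempty X] {f : X → ℝ} {c : ℝ} (h : ∀ x, f x ≤ c) : av f ≤ c := by
  rw [← av_const (X := X) c]; exact av_mono h

lemma le_av [Nonempty X] {f : X → ℝ} {c : ℝ} (h : ∀ x, c ≤ f x) : c ≤ av f := by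
  rw [← av_const (X := X) c]; exact av_mono h

lemma av_comm (f : X → Y → ℝ) :
    av (fun x => av (fun y => f x y)) = av (fun y => av (fun x => f x y)) := by
  unfold av
  simp only [← Finset.sum_div]
  rw [Finset.sum_comm]; ring

lemma av_equiv (e : X ≃ Y) (f : Y → ℝ) : av (fun x => f (e x)) = av f := by
  have := Fintype.ofFinite X
  have := Fintype.ofFinite Y
  rw [av_eq, av_eq, Fintype.card_congr e, e.sum_comp]

lemma av_prod (f : X × Y → ℝ) : av f = av (fun x => av (fun y => f (x, y))) := by
  have := Fintype.ofFinite X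
  have := Fintype.ofFinite Y
  simp only [av_eq]
  rw [Fintype.sum_prod_type, Fintype.card_prod, ← Finset.sum_div, div_div]
  push_cast; ring

lemma av_finset_sum {S : Type*} (s : Finset S) (f : S → X → ℝ) :
    av (fun x => ∑ i ∈ s, f i x) = ∑ i ∈ s, av (f i) := by
  unfold av; rw [Finset.sum_comm, Finset.sum_div]

lemma exists_le_of_le_av [Nonempty X] {f : X → ℝ} {c : ℝ} (h : c ≤ av f) : ∃ x, c ≤ f x := by
  by_contra hc
  push Not at hc
  have := Fintype.ofFinite X
  have h2 : av f < c := by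
    rw [av_eq, div_lt_iff₀ (by positivity)]
    calc ∑ x, f x < ∑ x : X, c := Finset.sum_lt_sum_of_nonempty Finset.univ_nonempty (fun x _ => hc x)
      _ = _ := by simp [mul_comm]
  linarith

lemma mu_nonneg (A : Set X) : 0 ≤ mu A := av_nonneg fun _ => ind_nonneg _
lemma mu_le_one [Nonempty X] (A : Set X) : mu A ≤ 1 := av_le fun _ => ind_le_one _

lemma nonempty_of_mu_pos {A : Set X} (h : 0 < mu A) : A.Nonempty := by
  by_contra hA
  rw [Set.not_nonempty_iff_eq_empty] at hA
  subst hA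
  simp [mu, av, ind] at h

lemma av_words {ι κ β : Type*} [Finite ι] [Finite κ] [Finite β] (F : (ι ⊕ κ → β) → ℝ) :
    av F = av (fun y : κ → β => av (fun x : ι → β => F (Sum.elim x y))) := by
  rw [← av_comm, ← av_prod (fun p : (ι → β) × (κ → β) => F (Sum.elim p.1 p.2)),
    ← av_equiv (Equiv.sumArrowEquivProdArrow ι κ β).symm F]
  rfl

lemma av_update {M : Type*} [Finite M] (j : M) (F : (M → X) → ℝ) :
    av (fun w => av (fun v => F (Function.update w j v))) = av F := by
  have h1 : av F = av (fun r => av (fun v => F ((Equiv.funSplitAt j X).symm (v, r)))) := by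
    rw [← av_equiv (Equiv.funSplitAt j X).symm F, av_prod, av_comm]
  have h2 : av (fun w => av (fun v => F (Function.update w j v))) = av (fun r => av (fun v' =>
      av (fun v => F (Function.update ((Equiv.funSplitAt j X).symm (v', r)) j v)))) := by
    rw [← av_equiv (Equiv.funSplitAt j X).symm
      (fun w => av (fun v => F (Function.update w j v))), av_prod, av_comm]
  rw [h1, h2]
  congr 1; ext r
  rcases isEmpty_or_nonempty X with h | h
  · simp [av]
  have : ∀ (x v : X), Function.update ((Equiv.funSplitAt j X).symm (x, r)) j v
      = (Equiv.funSplitAt j X).symm (v, r) := by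
    intro x v
    ext i
    by_cases h : i = j
    · subst h; simp [Equiv.funSplitAt, Equiv.piSplitAt]
    · simp [Equiv.funSplitAt, Equiv.piSplitAt, h]
  simp only [this]
  rw [av_const]

/-- Averages over the range of an injective map. -/
lemma av_range (φ : Y → X) (hφ : Function.Injective φ) [Nonempty Y] (f : X → ℝ) :
    av (fun x => f x * ind (x ∈ Set.range φ)) = (Nat.card Y / Nat.card X : ℝ) * av (fun y => f (φ y)) := by
  have := Fintype.ofFinite X
  have := Fintype.ofFinite Y
  rw [av_eq, av_eq, Nat.card_eq_fintype_card, Nat.card_eq_fintype_card]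
  have h1 : ∑ x, f x * ind (x ∈ Set.range φ) = ∑ y, f (φ y) := by
    rw [← Finset.sum_image (s := Finset.univ) (g := φ) (f := f) (fun a _ b _ h => hφ h)]
    rw [← Finset.sum_subset (Finset.subset_univ (Finset.univ.image φ))]
    · apply Finset.sum_congr rfl
      intro x hx
      rw [ind_true (by simpa using hx), mul_one]
    · intro x _ hx
      rw [ind_false (by simpa using hx), mul_zero]
  rw [h1]
  have : (Fintype.card Y : ℝ) ≠ 0 := by positivity
  field_simp

/-- Markov plus pigeonhole. -/
lemma markov_pigeon [Nonempty Y] {C : Type*} [Finite C] (S : Y → Set X) (R : C → Y → Prop) [Nonempty X] (δ : ℝ)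
    (hδ : 0 < δ) (hS : 2 * δ ≤ av (fun y => mu (S y)))
    (hR : ∀ y, δ ≤ mu (S y) → ∃ c, R c y) : ∃ c, δ / Nat.card C ≤ mu {y | R c y} := by
  have := Fintype.ofFinite C
  have h1 : ∀ y, mu (S y) ≤ δ + ∑ c, ind (R c y) := by
    intro y
    by_cases h : δ ≤ mu (S y)
    · obtain ⟨c, hc⟩ := hR y h
      have : ind (R c y) ≤ ∑ c, ind (R c y) :=
        Finset.single_le_sum (f := fun c => ind (R c y)) (fun c _ => ind_nonneg _) (Finset.mem_univ c)
      rw [ind_true hc] at this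
      linarith [mu_le_one (S y)]
    · have : 0 ≤ ∑ c, ind (R c y) := Finset.sum_nonneg fun c _ => ind_nonneg _
      linarith
  have h2 := av_mono h1
  rw [av_add, av_const, av_finset_sum] at h2
  by_contra hc
  push Not at hc
  have h3 : ∑ c : C, mu {y | R c y} ≤ ∑ c : C, δ / Nat.card C :=
    Finset.sum_le_sum fun c _ => (hc c).le
  have hCne : Nonempty C := by
    by_contra hne
    rw [not_nonempty_iff] at hne
    simp at h2
    linarith
  have h4 : ∑ c : C, mu {y | R c y} < ∑ c : C, δ / Nat.card C :=
    Finset.sum_lt_sum_of_nonempty Finset.univ_nonempty fun c _ => (hc c)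
  have h5 : ∑ c : C, δ / Nat.card C = δ := by
    simp; field_simp
  have h6 : ∑ c : C, mu {y | R c y} = ∑ c : C, av (fun y => ind (R c y)) := rfl
  linarith

end av

/-! ### Subspaces -/

def sp {ι β η : Type} (T : ι → β ⊕ η) (x : η → β) : ι → β := fun i => Sum.elim id x (T i)

def Proper {ι β η : Type} (T : ι → β ⊕ η) : Prop := ∀ e, ∃ i, T i = Sum.inr e

lemma sp_injective {ι β η : Type} {T : ι → β ⊕ η} (hT : Proper T) : Function.Injective (sp T) := by
  intro x y h
  ext e
  obtain ⟨i, hi⟩ := hT e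
  have := congrFun h i
  simpa [sp, hi] using this

def comp {ι β η ζ : Type} (T : ι → β ⊕ η) (U : η → β ⊕ ζ) : ι → β ⊕ ζ :=
  fun i => Sum.elim Sum.inl U (T i)

lemma sp_comp {ι β η ζ : Type} (T : ι → β ⊕ η) (U : η → β ⊕ ζ) (x : ζ → β) :
    sp (comp T U) x = sp T (sp U x) := by
  ext i
  unfold sp comp
  cases T i <;> simp

lemma proper_comp {ι β η ζ : Type} {T : ι → β ⊕ η} {U : η → β ⊕ ζ} (hT : Proper T) (hU : Proper U) :
    Proper (comp T U) := by
  intro e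
  obtain ⟨j, hj⟩ := hU e
  obtain ⟨i, hi⟩ := hT j
  exact ⟨i, by simp [comp, hi, hj]⟩

/-- Density Hales-Jewett property for a single dimension type. -/
def PD (α η : Type) [Finite α] : Prop := ∀ δ : ℝ, 0 < δ → ∃ (ι : Type) (_ : Finite ι),
  ∀ A : Set (ι → α), δ ≤ mu A → ∃ T : ι → α ⊕ η, Proper T ∧ ∀ x, sp T x ∈ A

def P (α : Type) [Finite α] : Prop := ∀ (η : Type) [Finite η], PD α η

lemma P_unit : P Unit := by
  intro η _ δ hδ
  refine ⟨η, inferInstance, fun A hA => ⟨Sum.inr, fun e => ⟨e, rfl⟩, fun x => ?_⟩⟩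
  obtain ⟨y, hy⟩ := nonempty_of_mu_pos (hδ.trans_le hA)
  convert hy

/-- Lines give subspaces. -/
lemma P_of_line (α : Type) [Finite α] [Nonempty α] (h : PD α Unit) : P α := by
  intro η hη
  refine Finite.induction_empty_option (P := fun η => PD α η) ?_ ?_ ?_ η
  · intro η ζ e hη δ hδ
    obtain ⟨ι, hι, H⟩ := hη δ hδ
    refine ⟨ι, hι, fun A hA => ?_⟩
    obtain ⟨T, hT, hTA⟩ := H A hA
    refine ⟨fun i => (T i).map id e, fun z => ?_, fun x => ?_⟩
    · obtain ⟨i, hi⟩ := hT (e.symm z)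
      exact ⟨i, by simp [hi]⟩
    · convert hTA (x ∘ e) using 1
      ext i
      unfold sp
      dsimp only
      cases T i <;> simp
  · intro δ hδ
    refine ⟨PEmpty, inferInstance, fun A hA => ?_⟩
    obtain ⟨y, hy⟩ := nonempty_of_mu_pos (hδ.trans_le hA)
    exact ⟨fun i => i.elim, fun e => e.elim, fun x => by convert hy using 1; ext i; exact i.elim⟩
  · intro η _ hη δ hδ
    have : Finite η := inferInstance
    obtain ⟨ι, hι, H⟩ := hη (δ / 2) (by positivity)
    have hc : (0 : ℝ) < Nat.card (ι → α ⊕ η) := by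
      have : Nonempty (ι → α ⊕ η) := ⟨fun _ => Sum.inl (Classical.arbitrary α)⟩
      exact_mod_cast Nat.card_pos
    obtain ⟨κ, hκ, K⟩ := h (δ / 2 / Nat.card (ι → α ⊕ η)) (by positivity)
    refine ⟨ι ⊕ κ, inferInstance, fun A hA => ?_⟩
    obtain ⟨T, hT⟩ := markov_pigeon (X := ι → α) (Y := κ → α) (C := ι → α ⊕ η)
      (fun y => {x | Sum.elim x y ∈ A})
      (fun T y => Proper T ∧ ∀ x, Sum.elim (sp T x) y ∈ A) (δ / 2) (by positivity)
      (by rw [mu, av_words] at hA; simpa [mu, mul_div_cancel₀] using hA)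
      (fun y hy => H _ hy)
    obtain ⟨U, hU, hUA⟩ := K _ hT
    have hTp : Proper T := (hUA (fun _ => Classical.arbitrary α)).1
    refine ⟨Sum.elim (fun i => (T i).map id some) (fun k => (U k).map id (fun _ => none)), ?_, ?_⟩
    · intro e
      cases e with
      | none =>
        obtain ⟨i, hi⟩ := hU ()
        exact ⟨Sum.inr i, by simp [hi]⟩
      | some e =>
        obtain ⟨i, hi⟩ := hTp e
        exact ⟨Sum.inl i, by simp [hi]⟩
    · intro x
      convert (hUA (fun _ => x none)).2 (fun e => x (some e)) using 1
      ext i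
      unfold sp
      rcases i with i | i
      · simp only [Sum.elim_inl]
        cases T i <;> simp
      · simp only [Sum.elim_inr]
        cases U i <;> simp

lemma PD_up {α η : Type} [Finite α] [Nonempty α] (h : PD α η) (δ : ℝ) (hδ : 0 < δ) :
    ∃ N : ℕ, ∀ (ι : Type) [Finite ι], N ≤ Nat.card ι → ∀ A : Set (ι → α), δ ≤ mu A →
      ∃ T : ι → α ⊕ η, Proper T ∧ ∀ x, sp T x ∈ A := by
  obtain ⟨ι₀, h₀, H⟩ := h δ hδ
  refine ⟨Nat.card ι₀, fun ι _ hN A hA => ?_⟩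
  have := Fintype.ofFinite ι
  have := Fintype.ofFinite ι₀
  rw [Nat.card_eq_fintype_card, Nat.card_eq_fintype_card] at hN
  have hcard : Fintype.card ι = Fintype.card (ι₀ ⊕ Fin (Fintype.card ι - Fintype.card ι₀)) := by
    simp; omega
  let e := Fintype.equivOfCardEq hcard
  have hA2 : mu A = av (fun y : _ → α => av (fun x : ι₀ → α => ind ((Sum.elim x y) ∘ e ∈ A))) := by
    rw [← av_words (fun z => ind (z ∘ e ∈ A)), mu,
      ← av_equiv (Equiv.arrowCongr e (Equiv.refl α)).symm]
    rfl
  rw [hA2] at hA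
  obtain ⟨y, hy⟩ := exists_le_of_le_av hA
  obtain ⟨T, hT, hTA⟩ := H {x | (Sum.elim x y) ∘ e ∈ A} hy
  refine ⟨Sum.elim T (Sum.inl ∘ y) ∘ e, fun z => ?_, fun x => ?_⟩
  · obtain ⟨i, hi⟩ := hT z
    exact ⟨e.symm (Sum.inl i), by simp [hi]⟩
  · have : sp (Sum.elim T (Sum.inl ∘ y) ∘ e) x = Sum.elim (sp T x) y ∘ e := by
      ext i
      unfold sp
      simp only [Function.comp]
      cases e i <;> simp
    rw [this]
    exact hTA x

noncomputable def extN {α : Type} {n : ℕ} (s : Finset (Fin n)) (z : s → α) : Fin n → Option α :=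
  fun i => if h : i ∈ s then some (z ⟨i, h⟩) else none

lemma extN_injective {α : Type} {n : ℕ} (s : Finset (Fin n)) :
    Function.Injective (extN (α := α) s) := by
  intro x y h
  ext ⟨i, hi⟩
  have := congrFun h i
  simpa [extN, hi] using this

lemma sum_extN {α : Type} [Fintype α] {n : ℕ} (f : (Fin n → Option α) → ℝ) :
    ∑ x, f x = ∑ s : Finset (Fin n), ∑ z : s → α, f (extN s z) := by
  rw [← Finset.sum_fiberwise Finset.univ
    (fun x : Fin n → Option α => (Finset.univ.filter fun i => x i ≠ none)) f]
  apply Finset.sum_congr rfl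
  intro s _
  rw [← Finset.sum_image (s := Finset.univ) (g := extN s) (f := f)
    (fun a _ b _ h => extN_injective s h)]
  apply Finset.sum_congr _ (fun _ _ => rfl)
  ext x
  simp only [Finset.mem_filter, Finset.mem_univ, true_and, Finset.mem_image]
  constructor
  · rintro rfl
    have hx : ∀ i : (Finset.univ.filter fun i => x i ≠ none), ∃ a, x i = some a := by
      rintro ⟨i, hi⟩
      simp only [Finset.mem_filter, Finset.mem_univ, true_and] at hi
      exact Option.ne_none_iff_exists'.1 hi
    choose z hz using hx
    refine ⟨z, ?_⟩
    ext1 i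
    by_cases hi : x i = none
    · simp [extN, hi]
    · have : i ∈ (Finset.univ.filter fun i => x i ≠ none) := by simp [hi]
      simp only [extN, this, dif_pos]
      exact (hz ⟨i, this⟩).symm
  · rintro ⟨z, rfl⟩
    ext i
    by_cases hi : i ∈ s <;> simp [extN, hi]

lemma dense_sub (α : Type) [Finite α] [Nonempty α] (N : ℕ) (ε : ℝ) (hε : 0 < ε) :
    ∃ n : ℕ, ∀ A : Set (Fin n → Option α), ε ≤ mu A →
      ∃ s : Finset (Fin n), N ≤ s.card ∧ ε / 2 ≤ mu {z : s → α | extN s z ∈ A} := by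
  have := Fintype.ofFinite α
  set c : ℝ := (Fintype.card α : ℝ) with hc
  have hc1 : 0 < c := by rw [hc]; positivity
  obtain ⟨n, hn⟩ : ∃ n : ℕ, ((c / 2 + 1) / (c + 1)) ^ n < ε / 2 / 2 ^ N :=
    exists_pow_lt_of_lt_one (by positivity) (by rw [div_lt_one (by positivity)]; linarith)
  rw [div_pow, div_lt_iff₀ (by positivity)] at hn
  refine ⟨n, fun A hA => ?_⟩
  by_contra hcon
  push Not at hcon
  have hcount : ∀ s : Finset (Fin n), ∑ z : s → α, ind (extN s z ∈ A) ≤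
      ε / 2 * c ^ s.card + 2 ^ N * (c / 2) ^ s.card := by
    intro s
    have hcs : (Fintype.card (s → α) : ℝ) = c ^ s.card := by simp [hc]
    by_cases hs : N ≤ s.card
    · have h1 := hcon s hs
      rw [mu, av_eq, div_lt_iff₀ (by positivity), hcs] at h1
      have : 0 ≤ (2 : ℝ) ^ N * (c / 2) ^ s.card := by positivity
      exact h1.le.trans (by linarith)
    · have h1 : ∑ z : s → α, ind (extN s z ∈ A) ≤ c ^ s.card := by
        rw [← hcs]
        calc _ ≤ ∑ z : s → α, (1 : ℝ) := Finset.sum_le_sum fun _ _ => ind_le_one _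
          _ = _ := by simp
      have h2 : c ^ s.card ≤ 2 ^ N * (c / 2) ^ s.card := by
        rw [div_pow, mul_div_assoc', le_div_iff₀ (by positivity), mul_comm]
        gcongr
        · norm_num
        · omega
      have : 0 ≤ ε / 2 * c ^ s.card := by positivity
      linarith
  have hpow : ∀ x : ℝ, ∑ s : Finset (Fin n), x ^ s.card = (x + 1) ^ n := by
    intro x
    have := Fintype.sum_pow_mul_eq_add_pow (Fin n) x 1
    simpa using this
  have h3 : ∑ x, ind (x ∈ A) ≤ ε / 2 * (c + 1) ^ n + 2 ^ N * (c / 2 + 1) ^ n := by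
    rw [sum_extN, ← hpow, ← hpow, Finset.mul_sum, Finset.mul_sum, ← Finset.sum_add_distrib]
    exact Finset.sum_le_sum fun s _ => hcount s
  have hcs : (Fintype.card (Fin n → Option α) : ℝ) = (c + 1) ^ n := by simp [hc]
  rw [mu, av_eq, le_div_iff₀ (by positivity), hcs] at hA
  have h4 : 2 ^ N * (c / 2 + 1) ^ n < ε / 2 * (c + 1) ^ n := by
    calc _ < 2 ^ N * (ε / 2 / 2 ^ N * (c + 1) ^ n) := by gcongr
      _ = _ := by field_simp
  linarith

def orA {ι α : Type} (a : α) (v : ι → Option α) : ι → Option α := fun i => (v i).or (some a)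

def Ins {ι α : Type} (a : α) (E : Set (ι → Option α)) : Prop := ∀ v, orA a v ∈ E ↔ v ∈ E

lemma ins_sub {α : Type} [Finite α] [Nonempty α] (hP : P α) (a : α) (η : Type) [Finite η]
    (ε : ℝ) (hε : 0 < ε) : ∃ (M : Type) (_ : Finite M), ∀ E : Set (M → Option α), Ins a E →
      ε ≤ mu E → ∃ T : M → Option α ⊕ η, Proper T ∧ ∀ x, sp T x ∈ E := by
  obtain ⟨N, hN⟩ := PD_up (hP η) (ε / 2) (by positivity)
  obtain ⟨n, hn⟩ := dense_sub α N ε hε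
  refine ⟨Fin n, inferInstance, fun E hE hmu => ?_⟩
  obtain ⟨s, hs, hs2⟩ := hn E hmu
  obtain ⟨T, hT, hTA⟩ := hN s (by simpa using hs) _ hs2
  refine ⟨fun i => if h : i ∈ s then (T ⟨i, h⟩).map some id else Sum.inl none, fun e => ?_, fun x => ?_⟩
  · obtain ⟨⟨i, hi⟩, h2⟩ := hT e
    exact ⟨i, by simp [hi, h2]⟩
  · have h1 := hTA (fun e => (x e).getD a)
    rw [Set.mem_ofPred_eq, ← hE] at h1
    rw [← hE]
    convert h1 using 1
    ext1 i
    by_cases hi : i ∈ s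
    · simp only [orA, sp, extN, hi, dif_pos]
      cases hT : T ⟨i, hi⟩ with
      | inl b => simp
      | inr e => simp only [Sum.map_inr, Sum.elim_inr, id]; cases x e <;> simp
    · simp [orA, sp, extN, hi]

lemma ins_sp {ι η α : Type} {a : α} {E : Set (ι → Option α)} (hE : Ins a E) (T : ι → Option α ⊕ η) :
    Ins a {x | sp T x ∈ E} := by
  intro v
  rw [Set.mem_ofPred_eq, Set.mem_ofPred_eq, ← hE, ← hE (sp T v)]
  have : orA a (sp T (orA a v)) = orA a (sp T v) := by
    ext1 i
    simp only [orA, sp]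
    cases T i with
    | inl b => simp
    | inr e => simp only [Sum.elim_inr, orA]; cases v e <;> simp
  rw [this]

lemma sp_left {ι κ β η : Type} (T : ι → β ⊕ η) (y : κ → β) (x : η → β) :
    sp (Sum.elim T (Sum.inl ∘ y)) x = Sum.elim (sp T x) y := by
  ext i; cases i <;> simp [sp]

lemma sp_right {ι κ β η : Type} (T : κ → β ⊕ η) (y : ι → β) (x : η → β) :
    sp (Sum.elim (Sum.inl ∘ y) T) x = Sum.elim y (sp T x) := by
  ext i; cases i <;> simp [sp]

lemma proper_left {ι κ β η : Type} {T : ι → β ⊕ η} (hT : Proper T) (y : κ → β) :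
    Proper (Sum.elim T (Sum.inl ∘ y)) := fun e => by
  obtain ⟨i, hi⟩ := hT e
  exact ⟨Sum.inl i, by simp [hi]⟩

lemma proper_right {ι κ β η : Type} {T : κ → β ⊕ η} (hT : Proper T) (y : ι → β) :
    Proper (Sum.elim (Sum.inl ∘ y) T) := fun e => by
  obtain ⟨i, hi⟩ := hT e
  exact ⟨Sum.inr i, by simp [hi]⟩

lemma ins_right {ι κ α : Type} {a : α} {E : Set (ι ⊕ κ → Option α)} (hE : Ins a E) (x : ι → Option α) :
    Ins a {y | Sum.elim x y ∈ E} := by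
  have := ins_sp hE (Sum.elim (Sum.inl ∘ x) (Sum.inr : κ → Option α ⊕ κ))
  simp only [sp_right] at this
  exact this

lemma ins_left {ι κ α : Type} {a : α} {E : Set (ι ⊕ κ → Option α)} (hE : Ins a E) (y : κ → Option α) :
    Ins a {x | Sum.elim x y ∈ E} := by
  have := ins_sp hE (Sum.elim (Sum.inr : ι → Option α ⊕ ι) (Sum.inl ∘ y))
  simp only [sp_left] at this
  exact this

lemma c1_aux {α : Type} [Finite α] [Nonempty α] (a : α) (η : Type) [Finite η]
    (ε : ℝ) (hε : 0 < ε) (M : Type) [Finite M] (hM : ∀ E : Set (M → Option α), Ins a E →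
      ε / 2 ≤ mu E → ∃ T : M → Option α ⊕ η, Proper T ∧ ∀ x, sp T x ∈ E)
    (θ : ℝ) (hθ0 : 0 < θ) (hθ1 : θ ≤ 1)
    (hθ : θ ≤ (ε / 2 / Nat.card (M → Option α ⊕ η)) * (1 / Nat.card (M → Option α))) (t : ℕ) :
    ∃ (ι : Type) (_ : Finite ι), ∀ (g : (ι → Option α) → ℝ) (E : Set (ι → Option α)),
      (∀ x, g x ≤ 1) → Ins a E →
      (∀ T : ι → Option α ⊕ η, Proper T → av (fun x => g (sp T x)) ≤ ε) →
      av (fun x => g x * ind (x ∈ E)) ≤ ε * mu E + ε + (1 - θ) ^ t * mu E := by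
  have hq : 0 ≤ 1 - θ := by linarith
  have triv : ∀ (ι : Type) [Finite ι] (g : (ι → Option α) → ℝ) (E : Set (ι → Option α)),
      (∀ x, g x ≤ 1) → av (fun x => g x * ind (x ∈ E)) ≤ mu E := by
    intro ι _ g E hg
    apply av_mono
    intro x
    nlinarith [hg x, ind_nonneg (x ∈ E)]
  induction t with
  | zero =>
    refine ⟨PEmpty, inferInstance, fun g E hg _ _ => ?_⟩
    have := triv _ g E hg
    have := mul_nonneg hε.le (mu_nonneg E)
    linarith
  | succ t ih =>
    obtain ⟨ι, hι, H⟩ := ih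
    refine ⟨M ⊕ ι, inferInstance, fun g E hg hE hav => ?_⟩
    have hqt : 0 ≤ (1 - θ) ^ t := by positivity
    by_cases hEε : mu E < ε
    · have h1 := triv _ g E hg
      have h2 := mul_nonneg hε.le (mu_nonneg E)
      have h3 : 0 ≤ (1 - θ) ^ (t + 1) * mu E := mul_nonneg (by positivity) (mu_nonneg E)
      linarith
    push Not at hEε
    have hne : Nonempty (M → Option α ⊕ η) := ⟨fun _ => Sum.inl none⟩
    have hcC : (0 : ℝ) < Nat.card (M → Option α ⊕ η) := by exact_mod_cast Nat.card_pos
    obtain ⟨T, hT⟩ := markov_pigeon (X := M → Option α) (Y := ι → Option α) (C := M → Option α ⊕ η)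
      (fun y => {x | Sum.elim x y ∈ E})
      (fun T y => Proper T ∧ ∀ x, Sum.elim (sp T x) y ∈ E) (ε / 2) (by positivity)
      (by rw [mu, av_words] at hEε; simpa [mu, mul_div_cancel₀] using hEε)
      (fun y hy => hM _ (ins_left hE y) hy)
    set Y : Set (ι → Option α) := {y | ∀ x, Sum.elim (sp T x) y ∈ E} with hY
    have hTp : Proper T := by
      have : 0 < ε / 2 / Nat.card (M → Option α ⊕ η) := by positivity
      obtain ⟨y, hy⟩ := nonempty_of_mu_pos (this.trans_le hT)
      exact hy.1
    have hmuY : ε / 2 / Nat.card (M → Option α ⊕ η) ≤ mu Y := by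
      convert hT using 3
      ext y
      simp [hTp]
    have hYins : Ins a Y := by
      intro v
      simp only [hY, Set.mem_ofPred_eq]
      exact forall_congr' fun x => ins_right hE (sp T x) v
    set r : ℝ := Nat.card (η → Option α) / Nat.card (M → Option α) with hr
    have hr0 : 0 ≤ r := by positivity
    have hr1 : 1 / (Nat.card (M → Option α) : ℝ) ≤ r := by
      rw [hr]
      gcongr
      exact_mod_cast Nat.card_pos
    set E' : (M → Option α) → Set (ι → Option α) :=
      fun x => {y | Sum.elim x y ∈ E ∧ ¬ (x ∈ Set.range (sp T) ∧ y ∈ Y)} with hE'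
    have hE'ins : ∀ x, Ins a (E' x) := by
      intro x v
      have h1 := ins_right hE x v
      have h2 := hYins v
      simp only [hE', Set.mem_ofPred_eq] at h1 ⊢
      rw [h1, h2]
    have hsplit : ∀ x y, ind (Sum.elim x y ∈ E) =
        ind (y ∈ E' x) + ind (x ∈ Set.range (sp T)) * ind (y ∈ Y) := by
      intro x y
      by_cases hx : x ∈ Set.range (sp T)
      · by_cases hy : y ∈ Y
        · have h1 : Sum.elim x y ∈ E := by
            obtain ⟨v, rfl⟩ := hx
            exact hy v
          have h2 : y ∉ E' x := fun h => h.2 ⟨hx, hy⟩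
          rw [ind_true h1, ind_false h2, ind_true hx, ind_true hy]; norm_num
        · rw [ind_false hy]
          have : (y ∈ E' x) = (Sum.elim x y ∈ E) := by
            simp only [hE', Set.mem_ofPred_eq, hy, and_false, not_false_eq_true, and_true]
          rw [this]; ring
      · rw [ind_false hx]
        have : (y ∈ E' x) = (Sum.elim x y ∈ E) := by
          simp only [hE', Set.mem_ofPred_eq, hx, false_and, not_false_eq_true, and_true]
        rw [this]; ring
    -- measure of E
    have hmuE : mu E = av (fun x => mu (E' x)) + r * mu Y := by
      rw [mu, av_words]
      simp only [hsplit, av_add]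
      congr 1
      · rw [av_comm]; rfl
      · have : ∀ y, av (fun x => ind (x ∈ Set.range (sp T)) * ind (y ∈ Y)) = r * ind (y ∈ Y) := by
          intro y
          have := av_range (sp T) (sp_injective hTp) (fun _ => ind (y ∈ Y))
          rw [av_const] at this
          rw [hr, ← this]
          simp only [mul_comm]
        simp only [this, av_mul]
        rfl
    -- main part
    have h1 : av (fun x => av (fun y => g (Sum.elim x y) * ind (y ∈ E' x))) ≤
        (ε + (1 - θ) ^ t) * av (fun x => mu (E' x)) + ε := by
      rw [← av_mul, ← av_const (X := M → Option α) ε, ← av_add, av_const]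
      apply av_mono
      intro x
      have := H (fun y => g (Sum.elim x y)) (E' x) (fun y => hg _) (hE'ins x) (fun U hU => by
        have := hav _ (proper_right hU x)
        simpa only [sp_right] using this)
      linarith
    have h2 : av (fun y => av (fun x => g (Sum.elim x y) *
        (ind (x ∈ Set.range (sp T)) * ind (y ∈ Y)))) ≤ ε * (r * mu Y) := by
      rw [← mul_assoc, mu, ← av_mul]
      apply av_mono
      intro y
      have e1 := av_range (sp T) (sp_injective hTp) (fun x => g (Sum.elim x y))
      have e2 := hav _ (proper_left hTp y)
      simp only [sp_left] at e2
      have e3 : av (fun x => g (Sum.elim x y) * (ind (x ∈ Set.range (sp T)) * ind (y ∈ Y)))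
          = ind (y ∈ Y) * (r * av (fun v => g (Sum.elim (sp T v) y))) := by
        rw [hr, ← e1, ← av_mul]
        congr 1; ext x; ring
      rw [e3]
      have := mul_le_mul_of_nonneg_left (mul_le_mul_of_nonneg_left e2 hr0) (ind_nonneg (y ∈ Y))
      linarith
    have h3 : av (fun x => g x * ind (x ∈ E)) =
        av (fun x => av (fun y => g (Sum.elim x y) * ind (y ∈ E' x))) +
        av (fun y => av (fun x => g (Sum.elim x y) *
          (ind (x ∈ Set.range (sp T)) * ind (y ∈ Y)))) := by
      rw [av_words, av_comm (fun x y => g (Sum.elim x y) * ind (y ∈ E' x)), ← av_add]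
      congr 1; ext y
      rw [← av_add]
      congr 1; ext x
      rw [hsplit]; ring
    have h4 : θ ≤ r * mu Y := by
      refine hθ.trans ?_
      rw [mul_comm]
      gcongr
    have h5 : θ * mu E ≤ r * mu Y := by
      have := mu_le_one E
      have : θ * mu E ≤ θ := mul_le_of_le_one_right hθ0.le this
      linarith
    have h6 := mul_le_mul_of_nonneg_left h5 hqt
    have h7 : av (fun x => mu (E' x)) = mu E - r * mu Y := by linarith
    rw [h3]
    rw [h7] at h1
    rw [pow_succ]
    linarith

lemma c1 {α : Type} [Finite α] [Nonempty α] (hP : P α) (a : α) (η : Type) [Finite η]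
    (ε : ℝ) (hε : 0 < ε) :
    ∃ (ι : Type) (_ : Finite ι), ∀ (g : (ι → Option α) → ℝ) (E : Set (ι → Option α)),
      (∀ x, g x ≤ 1) → Ins a E →
      (∀ T : ι → Option α ⊕ η, Proper T → av (fun x => g (sp T x)) ≤ ε) →
      av (fun x => g x * ind (x ∈ E)) ≤ 3 * ε := by
  obtain ⟨M, _, hM⟩ := ins_sub hP a η (ε / 2) (by positivity)
  have hne : Nonempty (M → Option α ⊕ η) := ⟨fun _ => Sum.inl none⟩
  have hcC : (0 : ℝ) < Nat.card (M → Option α ⊕ η) := by exact_mod_cast Nat.card_pos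
  have hcC' : (0 : ℝ) < Nat.card (M → Option α) := by exact_mod_cast Nat.card_pos
  set θ : ℝ := min 1 ((ε / 2 / Nat.card (M → Option α ⊕ η)) * (1 / Nat.card (M → Option α))) with hθ
  have hθ0 : 0 < θ := lt_min one_pos (by positivity)
  obtain ⟨t, ht⟩ := exists_pow_lt_of_lt_one hε (show 1 - θ < 1 by linarith)
  obtain ⟨ι, hι, H⟩ := c1_aux a η ε hε M hM θ hθ0 (min_le_left _ _) (min_le_right _ _) t
  refine ⟨ι, hι, fun g E hg hE hav => (H g E hg hE hav).trans ?_⟩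
  have h1 := mu_le_one E
  have h0 := mu_nonneg E
  nlinarith

lemma c_all {α : Type} [Finite α] [Nonempty α] (hP : P α) (s : Finset α) (η : Type) [Finite η]
    (ε : ℝ) (hε : 0 < ε) :
    ∃ (ι : Type) (_ : Finite ι), ∀ (g : (ι → Option α) → ℝ) (E : α → Set (ι → Option α)),
      (∀ x, g x ≤ 1) → (∀ a, Ins a (E a)) →
      (∀ T : ι → Option α ⊕ η, Proper T → av (fun x => g (sp T x)) ≤ ε) →
      av (fun x => g x * ind (∀ a ∈ s, x ∈ E a)) ≤ 3 ^ s.card * ε := by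
  induction s using Finset.induction_on with
  | empty =>
    refine ⟨η, inferInstance, fun g E hg _ hav => ?_⟩
    have := hav Sum.inr (fun e => ⟨e, rfl⟩)
    have h : ∀ x : η → Option α, sp (Sum.inr : η → Option α ⊕ η) x = x := fun x => rfl
    simpa [ind, h] using this
  | insert a s ha ih =>
    obtain ⟨ι₁, _, H⟩ := ih
    obtain ⟨ι, hι, K⟩ := c1 hP a ι₁ (3 ^ s.card * ε) (by positivity)
    refine ⟨ι, hι, fun g E hg hE hav => ?_⟩
    have := K (fun x => g x * ind (∀ b ∈ s, x ∈ E b)) (E a) (fun x => ?_) (hE a) (fun T hT => ?_)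
    · rw [Finset.card_insert_of_notMem ha, pow_succ]
      refine le_trans (le_of_eq ?_) (this.trans (le_of_eq (by ring)))
      congr 1; ext x
      rw [mul_assoc]
      congr 1
      simp only [Finset.forall_mem_insert]
      by_cases h1 : x ∈ E a <;> by_cases h2 : ∀ b ∈ s, x ∈ E b <;> simp [ind, h1, h2]
    · have h1 := ind_nonneg (∀ b ∈ s, x ∈ E b)
      have h2 := ind_le_one (∀ b ∈ s, x ∈ E b)
      nlinarith [hg x]
    · exact H (fun x => g (sp T x)) (fun b => {x | sp T x ∈ E b}) (fun x => hg _)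
        (fun b => ins_sp (hE b) T) (fun U hU => by
          have := hav _ (proper_comp hT hU)
          simpa only [sp_comp] using this)

/-- Sets containing no combinatorial line. -/
def LF {ι β : Type} (A : Set (ι → β)) : Prop :=
  ∀ T : ι → β ⊕ Unit, Proper T → ∃ x, sp T x ∉ A

lemma LF_sp {ι β η : Type} {A : Set (ι → β)} (hA : LF A) {T : ι → β ⊕ η} (hT : Proper T) :
    LF {x | sp T x ∈ A} := by
  intro U hU
  obtain ⟨x, hx⟩ := hA _ (proper_comp hT hU)
  exact ⟨x, by rw [sp_comp] at hx; exact hx⟩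

lemma LF_right {ι κ β : Type} {A : Set (ι ⊕ κ → β)} (hA : LF A) (w : ι → β) :
    LF {y : κ → β | Sum.elim w y ∈ A} := by
  have := LF_sp hA (proper_right (T := (Sum.inr : κ → β ⊕ κ)) (fun e => ⟨e, rfl⟩) w)
  simp only [sp_right] at this
  exact this

/-- The template of a line over `α`, as a word over `Option α`. -/
def tpl {M α : Type} (T : M → α ⊕ Unit) (j : M) : Option α := Sum.elim some (fun _ => none) (T j)

def pt {M α p κ : Type} (T : M → α ⊕ Unit) (w : M → p → Option α) (y : κ → Option α) (b : Option α) :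
    (M ⊕ M × p) ⊕ κ → Option α :=
  Sum.elim (Sum.elim (fun j => (tpl T j).or b)
    (fun ji => (w ji.1 ji.2).or ((tpl T ji.1).or b))) y

def lft {α : Type} : Option α → Option α ⊕ Unit
  | none => Sum.inr ()
  | some a => Sum.inl (some a)

lemma lft_elim {α : Type} (c : Option α) (x : Unit → Option α) :
    Sum.elim id x (lft c) = c.or (x ()) := by
  cases c <;> simp [lft]

/-- The points `pt T w y b` form a combinatorial line. -/
lemma pt_line {M α p κ : Type} {A : Set ((M ⊕ M × p) ⊕ κ → Option α)} (hA : LF A)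
    {T : M → α ⊕ Unit} (hT : Proper T) (w : M → p → Option α) (y : κ → Option α) :
    ∃ b, pt T w y b ∉ A := by
  obtain ⟨j, hj⟩ := hT ()
  obtain ⟨x, hx⟩ := hA (Sum.elim (Sum.elim (fun j => lft (tpl T j))
    (fun ji => lft ((w ji.1 ji.2).or (tpl T ji.1)))) (Sum.inl ∘ y)) (fun _ => 
      ⟨Sum.inl (Sum.inl j), by simp [tpl, hj, lft]⟩)
  refine ⟨x (), ?_⟩
  have e : pt T w y (x ()) = sp (Sum.elim (Sum.elim (fun j => lft (tpl T j))
    (fun ji => lft ((w ji.1 ji.2).or (tpl T ji.1)))) (Sum.inl ∘ y)) x := by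
    ext1 i
    rcases i with (i | i) | i
    · simp [pt, sp, lft_elim]
    · simp [pt, sp, lft_elim, Option.or_assoc]
    · simp [pt, sp]
  rw [e]
  exact hx

lemma main_core {α M p κ : Type} [Finite α] [Nonempty α] [Finite M] [Finite p] [Finite κ]
    (δ ε₃ c θ ε₄ : ℝ) (hδ : 0 < δ) (hc : 0 < c) (hε₃ : ε₃ ≤ δ / 2)
    (hM : ∀ B : Set (M → α), δ / 4 ≤ mu B → ∃ T : M → α ⊕ Unit, Proper T ∧ ∀ x, sp T x ∈ B)
    (hθ : θ = δ / 4 / Nat.card (M → α ⊕ Unit))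
    (hp : ∀ A₀ : Set (p → Option α), LF A₀ → mu A₀ ≤ δ + ε₄)
    (hsmall : ε₃ + ε₄ ≤ c * (θ / 2)) (hε₃c : ε₃ ≤ c)
    (A : Set ((M ⊕ M × p) ⊕ κ → Option α)) (hA : LF A)
    (hsec : ∀ w, δ - ε₃ ≤ mu {y : κ → Option α | Sum.elim w y ∈ A}) :
    ∃ (A₀ : Set (p → Option α)) (C : α → Set (p → Option α)), LF A₀ ∧ (∀ a, Ins a (C a)) ∧
      (∀ v ∈ A₀, ∃ a, v ∉ C a) ∧ δ - 2 * c ≤ mu A₀ ∧ θ / 2 ≤ mu {v | ∀ a, v ∈ C a} := by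
  have hne : Nonempty (M → α ⊕ Unit) := ⟨fun _ => Sum.inr ()⟩
  have hcC : (0 : ℝ) < Nat.card (M → α ⊕ Unit) := by exact_mod_cast Nat.card_pos
  have hθ0 : 0 < θ := by rw [hθ]; positivity
  -- find the common line
  obtain ⟨T, hT⟩ := markov_pigeon (X := M → α) (Y := (M → p → Option α) × (κ → Option α))
    (C := M → α ⊕ Unit)
    (fun z => {u | Sum.elim (Sum.elim (fun j => some (u j))
      (fun ji => (z.1 ji.1 ji.2).or (some (u ji.1)))) z.2 ∈ A})
    (fun T z => Proper T ∧ ∀ a : α, pt T z.1 z.2 (some a) ∈ A) (δ / 4) (by positivity)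
    (by
      rw [av_prod]
      apply le_av
      intro w
      simp only [mu]
      rw [av_comm]
      apply le_av
      intro u
      have := hsec (Sum.elim (fun j => some (u j)) (fun ji => (w ji.1 ji.2).or (some (u ji.1))))
      rw [mu] at this
      refine le_trans ?_ this
      linarith)
    (fun z hz => by
      obtain ⟨T, hT, hTB⟩ := hM _ hz
      refine ⟨T, hT, fun a => ?_⟩
      convert hTB (fun _ => a) using 1
      have key : ∀ j, (tpl T j).or (some a) = some (sp T (fun _ => a) j) := by
        intro j
        simp only [tpl, sp]
        cases T j <;> simp
      simp only [pt, key]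
      rfl)
  rw [← hθ] at hT
  have hTp : Proper T := by
    obtain ⟨z, hz⟩ := nonempty_of_mu_pos (hθ0.trans_le hT)
    exact hz.1
  obtain ⟨j₀, hj₀⟩ := hTp ()
  have htpl : tpl T j₀ = none := by simp [tpl, hj₀]
  let D : (M → p → Option α) × (κ → Option α) → Set (p → Option α) :=
    fun z => {v | ∀ a : α, pt T (Function.update z.1 j₀ v) z.2 (some a) ∈ A}
  let A0 : (M → p → Option α) × (κ → Option α) → Set (p → Option α) :=
    fun z => {v | pt T (Function.update z.1 j₀ v) z.2 none ∈ A}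
  have hD : θ ≤ av (fun z => mu (D z)) := by
    refine hT.trans (le_of_eq ?_)
    rw [av_prod, mu, av_prod, av_comm, av_comm (fun w y => mu (D (w, y)))]
    congr 1; ext y
    rw [← av_update j₀]
    simp only [hTp, true_and]
    rfl
  have hA0 : δ - ε₃ ≤ av (fun z => mu (A0 z)) := by
    have : av (fun z => mu (A0 z)) = av (fun w => av (fun y => ind (pt T w y none ∈ A))) := by
      rw [av_prod, av_comm, av_comm (fun w y => ind (pt T w y none ∈ A))]
      congr 1; ext y
      rw [← av_update j₀ (fun w => ind (pt T w y none ∈ A))]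
      rfl
    rw [this]
    apply le_av
    intro w
    exact hsec _
  have hLF : ∀ z, LF (A0 z) := by
    intro z
    have := LF_sp hA (T := (Sum.elim (Sum.elim (Sum.inl ∘ tpl T)
      (fun ji : M × p => if ji.1 = j₀ then Sum.inr ji.2 else
        Sum.inl ((z.1 ji.1 ji.2).or (tpl T ji.1)))) (Sum.inl ∘ z.2))) (fun i =>
          ⟨Sum.inl (Sum.inr (j₀, i)), by simp⟩)
    convert this using 1
    ext v
    simp only [A0, Set.mem_ofPred_eq]
    have e : pt T (Function.update z.1 j₀ v) z.2 none = sp (Sum.elim (Sum.elim (Sum.inl ∘ tpl T)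
      (fun ji : M × p => if ji.1 = j₀ then Sum.inr ji.2 else
        Sum.inl ((z.1 ji.1 ji.2).or (tpl T ji.1)))) (Sum.inl ∘ z.2)) v := by
      ext1 i
      rcases i with (i | ⟨j, i⟩) | i
      · simp [pt, sp]
      · by_cases hj : j = j₀
        · subst hj
          simp [pt, sp, htpl]
        · simp [pt, sp, hj]
      · simp [pt, sp]
    rw [e]
  obtain ⟨z, hz⟩ : ∃ z, c * θ + (δ - ε₃) ≤ c * mu (D z) + mu (A0 z) := by
    apply exists_le_of_le_av
    rw [av_add, av_mul]
    gcongr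
  refine ⟨A0 z, fun a => {v | pt T (Function.update z.1 j₀ v) z.2 (some a) ∈ A}, hLF z, ?_, ?_, ?_, ?_⟩
  · intro a v
    simp only [Set.mem_ofPred_eq]
    have e : pt T (Function.update z.1 j₀ (orA a v)) z.2 (some a)
        = pt T (Function.update z.1 j₀ v) z.2 (some a) := by
      ext1 i
      rcases i with (i | ⟨j, i⟩) | i
      · simp [pt]
      · by_cases hj : j = j₀
        · subst hj
          simp [pt, htpl, orA]
        · simp [pt, hj]
      · simp [pt]
    rw [e]
  · intro v hv
    obtain ⟨b, hb⟩ := pt_line hA hTp (Function.update z.1 j₀ v) z.2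
    cases b with
    | none => exact absurd hv hb
    | some a => exact ⟨a, hb⟩
  · have h1 := mu_le_one (D z)
    have := mul_le_mul_of_nonneg_left h1 hc.le
    have : 0 ≤ c * θ := by positivity
    linarith
  · have h1 := hp _ (hLF z)
    have h2 : c * (θ / 2) ≤ c * mu (D z) := by linarith
    exact le_of_mul_le_mul_left h2 hc

lemma line_succ {α : Type} [Finite α] [Nonempty α] (hP : P α) : PD (Option α) Unit := by
  have := Fintype.ofFinite α
  by_contra hcon
  unfold PD at hcon
  push Not at hcon
  obtain ⟨δ₀, hδ₀, H₀⟩ := hcon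
  let S : Set ℝ := {δ | ∀ (ι : Type) (_ : Finite ι), ∃ A : Set (ι → Option α), LF A ∧ δ ≤ mu A}
  have hS₀ : δ₀ ∈ S := by
    intro ι hι
    obtain ⟨A, hA, hA2⟩ := H₀ ι hι
    exact ⟨A, hA2, hA⟩
  have hbdd : BddAbove S := by
    refine ⟨1, fun s hs => ?_⟩
    obtain ⟨A, _, hA⟩ := hs Unit inferInstance
    exact hA.trans (mu_le_one A)
  set δ := sSup S with hδdef
  have hδ : 0 < δ := hδ₀.trans_le (le_csSup hbdd hS₀)
  have up : ∀ ε : ℝ, 0 < ε → ∃ (ι : Type) (_ : Finite ι), ∀ A : Set (ι → Option α), LF A →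
      mu A ≤ δ + ε := by
    intro ε hε
    have : δ + ε ∉ S := fun h => by
      have := le_csSup hbdd h
      linarith
    simp only [S, Set.mem_ofPred_eq] at this
    push Not at this
    obtain ⟨ι, hι, h⟩ := this
    exact ⟨ι, hι, fun A hA => (h A hA).le⟩
  have low : ∀ ε : ℝ, 0 < ε → ∀ (ι : Type) (_ : Finite ι), ∃ A : Set (ι → Option α), LF A ∧
      δ - ε ≤ mu A := by
    intro ε hε ι hι
    obtain ⟨s, hs, hs2⟩ := exists_lt_of_lt_csSup ⟨δ₀, hS₀⟩ (show δ - ε < sSup S by linarith)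
    obtain ⟨A, hA, hA2⟩ := hs ι hι
    exact ⟨A, hA, by linarith⟩
  have hδ1 : δ ≤ 1 := csSup_le ⟨δ₀, hS₀⟩ (fun s hs => by
    obtain ⟨A, _, hA⟩ := hs Unit inferInstance
    exact hA.trans (mu_le_one A))
  -- parameters
  obtain ⟨M, _, hM⟩ := hP Unit (δ / 4) (by positivity)
  have hne : Nonempty (M → α ⊕ Unit) := ⟨fun _ => Sum.inr ()⟩
  have hcC : (1 : ℝ) ≤ Nat.card (M → α ⊕ Unit) := by
    exact_mod_cast (Nat.card_pos : 0 < Nat.card (M → α ⊕ Unit))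
  obtain ⟨θ, hθ⟩ : ∃ θ, θ = δ / 4 / (Nat.card (M → α ⊕ Unit) : ℝ) := ⟨_, rfl⟩
  have hθ0 : 0 < θ := by rw [hθ]; positivity
  have hθ1 : θ ≤ 1 := by
    rw [hθ]
    refine (div_le_self (by positivity) hcC).trans (by linarith)
  obtain ⟨c, hc⟩ : ∃ c, c = δ * θ / 16 := ⟨_, rfl⟩
  have hc0 : 0 < c := by rw [hc]; positivity
  set n := Fintype.card α with hn
  obtain ⟨ε₁, hε₁⟩ : ∃ ε₁ : ℝ, ε₁ = c * θ / (8 * 6 ^ n) := ⟨_, rfl⟩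
  have hε₁0 : 0 < ε₁ := by rw [hε₁]; positivity
  have h6 : 6 ^ n * ε₁ = c * θ / 8 := by rw [hε₁]; field_simp
  have h3n : 3 ^ n * ε₁ ≤ 6 ^ n * ε₁ := by gcongr; norm_num
  have h1n : ε₁ ≤ 6 ^ n * ε₁ := by
    have : (1 : ℝ) ≤ 6 ^ n := one_le_pow₀ (by norm_num)
    nlinarith
  have hcθ : c * θ ≤ c := by nlinarith
  obtain ⟨ζ, _, hζ⟩ := up ε₁ hε₁0
  obtain ⟨p, _, hp⟩ := c_all hP Finset.univ ζ ε₁ hε₁0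
  have hcA : ∀ A₀ : Set (p → Option α), LF A₀ → ∀ E : α → Set (p → Option α),
      (∀ a, Ins a (E a)) →
      av (fun v => (ind (v ∈ A₀) - (δ + ε₁)) * ind (∀ a, v ∈ E a)) ≤ 3 ^ n * ε₁ := by
    intro A₀ hA₀ E hE
    have := hp (fun v => ind (v ∈ A₀) - (δ + ε₁)) E (fun v => by linarith [ind_le_one (v ∈ A₀)]) hE
      (fun T hT => by
        rw [av_sub, av_const]
        have := hζ _ (LF_sp hA₀ hT)
        rw [mu] at this
        simp only [Set.mem_ofPred_eq] at this
        linarith)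
    simpa using this
  have hpA : ∀ A₀ : Set (p → Option α), LF A₀ → mu A₀ ≤ δ + (c * θ / 4) := by
    intro A₀ hA₀
    have := hcA A₀ hA₀ (fun _ => Set.univ) (fun a v => by simp)
    simp only [Set.mem_univ, implies_true, ind_true, mul_one] at this
    rw [av_sub, av_const] at this
    rw [mu]
    linarith
  -- regularize
  have hcW : (0 : ℝ) < Nat.card (M ⊕ M × p → Option α) := by exact_mod_cast Nat.card_pos
  obtain ⟨ε₂, hε₂⟩ : ∃ ε₂, ε₂ = c * θ / 8 / (Nat.card (M ⊕ M × p → Option α) : ℝ) := ⟨_, rfl⟩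
  have hε₂0 : 0 < ε₂ := by rw [hε₂]; positivity
  obtain ⟨κ, _, hκ⟩ := up ε₂ hε₂0
  obtain ⟨A, hA, hAmu⟩ := low ε₂ hε₂0 ((M ⊕ M × p) ⊕ κ) inferInstance
  have hsec : ∀ w, δ - c * θ / 4 ≤ mu {y : κ → Option α | Sum.elim w y ∈ A} := by
    intro w
    have h1 : δ - ε₂ ≤ av (fun w => mu {y : κ → Option α | Sum.elim w y ∈ A}) := by
      rw [mu, av_words, av_comm] at hAmu
      exact hAmu
    have h2 : (Nat.card (M ⊕ M × p → Option α) : ℝ) * (2 * ε₂) = c * θ / 4 := by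
      rw [hε₂]; field_simp; norm_num
    have := Fintype.ofFinite (M ⊕ M × p → Option α)
    rw [av_eq, le_div_iff₀ (by positivity), ← Finset.add_sum_erase _ _ (Finset.mem_univ w)] at h1
    have h3 : ∑ w ∈ Finset.univ.erase w, mu {y : κ → Option α | Sum.elim w y ∈ A} ≤
        ∑ w' ∈ Finset.univ.erase w, (δ + ε₂) :=
      Finset.sum_le_sum fun w' _ => hκ _ (LF_right hA w')
    have h4 : ∑ w' ∈ Finset.univ.erase w, (δ + ε₂) =
        (Fintype.card (M ⊕ M × p → Option α) : ℝ) * (δ + ε₂) - (δ + ε₂) := by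
      rw [eq_sub_iff_add_eq, Finset.sum_erase_add _ _ (Finset.mem_univ w)]
      simp [mul_add]
    rw [Nat.card_eq_fintype_card] at h2
    linarith
  obtain ⟨A₀, C, hA₀, hC, hdis, hmuA, hmuD⟩ := main_core δ (c * θ / 4) c θ (c * θ / 4) hδ hc0
    (by rw [hc] at hcθ ⊢; nlinarith) hM hθ hpA (by linarith) (by linarith) A hA hsec
  -- contradiction
  have hsplit : ∀ v, ind (v ∈ A₀) - (δ + ε₁) * (1 - ind (v ∈ {v | ∀ a, v ∈ C a})) =
      ∑ s ∈ (Finset.univ : Finset (Finset α)).erase ∅, (ind (v ∈ A₀) - (δ + ε₁)) *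
        ind (∀ a, v ∈ (if a ∈ s then (C a)ᶜ else C a)) := by
    intro v
    have hs : ∀ s : Finset α, (∀ a, v ∈ (if a ∈ s then (C a)ᶜ else C a)) ↔
        s = Finset.univ.filter (fun a => v ∉ C a) := by
      intro s
      constructor
      · intro h
        ext a
        have := h a
        by_cases ha : a ∈ s <;> simp_all
      · rintro rfl a
        by_cases ha : v ∈ C a <;> simp [ha]
    simp only [hs, ← Finset.mul_sum]
    simp only [Set.mem_ofPred_eq]
    by_cases hD : ∀ a, v ∈ C a
    · have h1 : v ∉ A₀ := fun h => by
        obtain ⟨a, ha⟩ := hdis v h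
        exact ha (hD a)
      have h2 : Finset.univ.filter (fun a => v ∉ C a) = ∅ := by simp [hD]
      rw [h2, ind_true hD, ind_false h1, Finset.sum_eq_zero]
      · ring
      · intro s hs
        exact ind_false (Finset.ne_of_mem_erase hs)
    · have h2 : Finset.univ.filter (fun a => v ∉ C a) ≠ ∅ := by
        intro h
        apply hD
        simpa [Finset.filter_eq_empty_iff] using h
      rw [ind_false hD, Finset.sum_eq_single (Finset.univ.filter (fun a => v ∉ C a)), ind_true rfl]
      · ring
      · intro s _ hs
        exact ind_false hs
      · intro h
        exact absurd (Finset.mem_erase.2 ⟨h2, Finset.mem_univ _⟩) h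
  have hpiece : ∀ s : Finset α, av (fun v => (ind (v ∈ A₀) - (δ + ε₁)) *
        ind (∀ a, v ∈ (if a ∈ s then (C a)ᶜ else C a))) ≤ 3 ^ n * ε₁ := by
    intro s
    apply hcA A₀ hA₀
    intro a v
    have := hC a v
    split_ifs <;> simp [this]
  have hsum := congrArg av (funext hsplit)
  rw [av_finset_sum, av_sub, av_mul, av_sub, av_const] at hsum
  have hle : ∑ s ∈ (Finset.univ : Finset (Finset α)).erase ∅, av (fun v => (ind (v ∈ A₀) - (δ + ε₁)) *
        ind (∀ a, v ∈ (if a ∈ s then (C a)ᶜ else C a))) ≤ 6 ^ n * ε₁ := by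
    calc _ ≤ ∑ s ∈ (Finset.univ : Finset (Finset α)).erase ∅, 3 ^ n * ε₁ :=
          Finset.sum_le_sum fun s _ => hpiece s
      _ ≤ ∑ s : Finset α, 3 ^ n * ε₁ :=
          Finset.sum_le_sum_of_subset_of_nonneg (Finset.erase_subset _ _)
            (fun _ _ _ => by positivity)
      _ = 6 ^ n * ε₁ := by
          rw [Finset.sum_const, Finset.card_univ, Fintype.card_finset, nsmul_eq_mul, ← mul_assoc]
          push_cast
          rw [← mul_pow]
          norm_num [hn]
  rw [← hsum] at hle
  change mu A₀ - (δ + ε₁) * (1 - mu {v | ∀ a, v ∈ C a}) ≤ _ at hle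
  have e1 : (δ + ε₁) * (1 - mu {v | ∀ a, v ∈ C a}) ≤ (δ + ε₁) * (1 - θ / 2) := by gcongr
  have e2 : 0 ≤ ε₁ * (θ / 2) := by positivity
  have e3 : δ * θ = 16 * c := by rw [hc]; ring
  linarith

lemma exists_alphabet (k : ℕ) : ∃ (α : Type) (_ : Finite α) (_ : Nonempty α) (v : α → ℕ),
    (∀ j ≤ k, ∃ a, v a = j) ∧ P α := by
  induction k with
  | zero => exact ⟨Unit, inferInstance, inferInstance, fun _ => 0, fun j hj => ⟨(), (Nat.le_zero.1 hj).symm⟩, P_unit⟩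
  | succ k ih =>
    obtain ⟨α, _, _, v, hv, hP⟩ := ih
    refine ⟨Option α, inferInstance, inferInstance, fun o => o.elim (k + 1) v, fun j hj => ?_,
      P_of_line _ (line_succ hP)⟩
    by_cases h : j = k + 1
    · exact ⟨none, h.symm⟩
    · obtain ⟨a, ha⟩ := hv j (by omega)
      exact ⟨some a, ha⟩

/-- Følner averaging. -/
lemma folner_point (F : ℕ → Finset ℚ) (hF : IsLeftFolner F) (A : Set ℚ)
    (hA : 0 < upperDensity F A) {X : Type} [Finite X] [Nonempty X] (φ : X → ℚ) :
    ∃ a : ℚ, upperDensity F A / 4 ≤ mu {x | φ x + a ∈ A} := by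
  set δ := upperDensity F A with hδ
  have hfreq : ∃ᶠ n in Filter.atTop, δ / 2 < (Set.ncard (A ∩ ↑(F n)) : ℝ) / (F n).card := by
    apply Filter.frequently_lt_of_lt_limsup
    · exact Filter.isCoboundedUnder_le_of_le Filter.atTop (x := 0) (fun n => by positivity)
    · change δ / 2 < δ
      linarith
  have hev : ∀ᶠ n in Filter.atTop, ∀ x, 
      ((((F n).image (φ x + ·)) ∆ (F n)).card : ℝ) / (F n).card < δ / 4 :=
    Filter.eventually_all.2 fun x => (hF.2 (φ x)).eventually_lt_const (by linarith)
  obtain ⟨n, hn1, hn2⟩ := (hfreq.and_eventually hev).exists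
  have hne := hF.1 n
  have hpos : (0 : ℝ) < (F n).card := by exact_mod_cast hne.card_pos
  have : Nonempty (F n) := hne.to_subtype
  have key : δ / 4 ≤ av (fun a : F n => mu {x | φ x + a ∈ A}) := by
    simp only [mu]
    rw [av_comm]
    apply le_av
    intro x
    have h2 := hn2 x
    rw [div_lt_iff₀ hpos] at h2
    rw [lt_div_iff₀ hpos] at hn1
    rw [av_eq, Fintype.card_coe, le_div_iff₀ hpos]
    have h3 : ∑ a : F n, ind (a ∈ {a : F n | φ x + a ∈ A}) =
        (((F n).filter (fun a => φ x + a ∈ A)).card : ℝ) := by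
      rw [Finset.card_filter]
      push_cast
      rw [← Finset.sum_coe_sort (F n)]
      rfl
    have h4 : Set.ncard (A ∩ ↑(F n)) = ((F n).filter (fun a => a ∈ A)).card := by
      rw [← Set.ncard_coe_finset]
      congr 1
      ext a
      simp [and_comm]
    have h5 : (F n).filter (fun a => a ∈ A) ⊆
        ((F n).filter (fun a => φ x + a ∈ A)).image (φ x + ·) ∪ (((F n).image (φ x + ·)) ∆ (F n)) := by
      intro a ha
      rw [Finset.mem_filter] at ha
      by_cases h : a ∈ (F n).image (φ x + ·)
      · apply Finset.mem_union_left
        obtain ⟨b, hb, rfl⟩ := Finset.mem_image.1 h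
        exact Finset.mem_image.2 ⟨b, Finset.mem_filter.2 ⟨hb, ha.2⟩, rfl⟩
      · apply Finset.mem_union_right
        rw [Finset.mem_symmDiff]
        exact Or.inr ⟨ha.1, h⟩
    have h6 := (Finset.card_le_card h5).trans (Finset.card_union_le _ _)
    have h7 := Finset.card_image_le (s := (F n).filter (fun a => φ x + a ∈ A)) (f := (φ x + ·))
    have h8 : (((F n).filter (fun a => a ∈ A)).card : ℝ) ≤
        ((F n).filter (fun a => φ x + a ∈ A)).card + (((F n).image (φ x + ·)) ∆ (F n)).card := by
      exact_mod_cast h6.trans (by gcongr)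
    rw [h4] at hn1
    have h9 : ∑ a : F n, ind (x ∈ {x | φ x + a ∈ A}) =
        (((F n).filter (fun a => φ x + a ∈ A)).card : ℝ) := h3
    rw [h9]
    linarith
  obtain ⟨a, ha⟩ := exists_le_of_le_av key
  exact ⟨a, ha⟩

end DHJ

/-- If `A ⊆ ℚ` has positive upper density along a left Følner sequence, then `A` contains
arithmetic progressions of every finite length: for each `k` there are a nonzero rational
`q` and `p ∈ A` with `p + jq ∈ A` for all `0 ≤ j ≤ k`. -/
theorem density_arithmetic_progressions (F : ℕ → Finset ℚ) (hF : IsLeftFolner F)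
    (A : Set ℚ) (hA : 0 < upperDensity F A) (k : ℕ) :
    ∃ q : ℚ, q ≠ 0 ∧ ∃ p ∈ A, ∀ j : ℕ, j ≤ k → p + (j : ℚ) * q ∈ A := by
  classical
  obtain ⟨α, _, _, v, hv, hP⟩ := DHJ.exists_alphabet k
  obtain ⟨ι, _, H⟩ := hP Unit (upperDensity F A / 4) (by positivity)
  have := Fintype.ofFinite ι
  obtain ⟨a, ha⟩ := DHJ.folner_point F hF A hA (fun x : ι → α => ∑ i, (v (x i) : ℚ))
  obtain ⟨T, hT, hTA⟩ := H _ ha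
  have hline : ∀ b : α, ∑ i, (v (DHJ.sp T (fun _ => b) i) : ℚ) =
      (∑ i, Sum.elim (fun c => (v c : ℚ)) (fun _ => 0) (T i)) +
        v b * ((Finset.univ.filter (fun i => T i = Sum.inr ())).card : ℚ) := by
    intro b
    rw [Finset.card_filter]
    push_cast
    rw [Finset.mul_sum, ← Finset.sum_add_distrib]
    apply Finset.sum_congr rfl
    intro i _
    unfold DHJ.sp
    cases T i <;> simp
  have hpt : ∀ j : ℕ, j ≤ k → ((∑ i, Sum.elim (fun c => (v c : ℚ)) (fun _ => 0) (T i)) + a) +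
      (j : ℚ) * ((Finset.univ.filter (fun i => T i = Sum.inr ())).card : ℚ) ∈ A := by
    intro j hj
    obtain ⟨b, hb⟩ := hv j hj
    have h1 : (∑ i, (v (DHJ.sp T (fun _ => b) i) : ℚ)) + a ∈ A := hTA (fun _ => b)
    rw [hline, hb] at h1
    convert h1 using 1
    ring
  refine ⟨((Finset.univ.filter (fun i => T i = Sum.inr ())).card : ℚ), ?_, _, ?_, hpt⟩
  · obtain ⟨i, hi⟩ := hT ()
    have : (Finset.univ.filter (fun i => T i = Sum.inr ())).Nonempty := ⟨i, by simp [hi]⟩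
    exact_mod_cast this.card_pos.ne'
  · have := hpt 0 (Nat.zero_le k)
    simpa using this
end

section
/- Let ℱ = (F_n)_{n∈ℕ} be a left Følner sequence of nonempty finite subsets of ℚ (under addition), and let A ⊆ ℚ with d̄_ℱ(A) > 0. Then for each k ∈ ℕ there exist a nonzero rational number q lying in the open interval (e^{−1} − 1, e^{−1}) and p ∈ A such that p + jq ∈ A for every 0 ≤ j ≤ k. -/
open scoped symmDiff

namespace DHJProof

open Combinatorics Finset
open scoped BigOperators

/-- average of a real function on a finite type -/
noncomputable def av {X : Type} [Finite X] (f : X → ℝ) : ℝ :=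
  (@Finset.sum X ℝ _ (@Finset.univ X (Fintype.ofFinite X)) f) / (Nat.card X : ℝ)

/-- real indicator of a proposition -/
noncomputable def ind (P : Prop) : ℝ := by
  classical
  exact if P then 1 else 0

lemma ind_true {P : Prop} (h : P) : ind P = 1 := by simp [ind, h]
lemma ind_false {P : Prop} (h : ¬ P) : ind P = 0 := by simp [ind, h]
lemma ind_nonneg (P : Prop) : 0 ≤ ind P := by
  by_cases h : P
  · rw [ind_true h]; norm_num
  · rw [ind_false h]
lemma ind_le_one (P : Prop) : ind P ≤ 1 := by
  by_cases h : P
  · rw [ind_true h]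
  · rw [ind_false h]; norm_num
lemma ind_congr {P Q : Prop} (h : P ↔ Q) : ind P = ind Q := by rw [propext h]
lemma ind_mono {P Q : Prop} (h : P → Q) : ind P ≤ ind Q := by
  by_cases hp : P
  · rw [ind_true hp, ind_true (h hp)]
  · rw [ind_false hp]; exact ind_nonneg _
lemma ind_not (P : Prop) : ind (¬ P) = 1 - ind P := by
  by_cases h : P
  · rw [ind_true h, ind_false (not_not.2 h)]; norm_num
  · rw [ind_false h, ind_true h]; norm_num
lemma ind_and (P Q : Prop) : ind (P ∧ Q) = ind P * ind Q := by
  by_cases h : P <;> by_cases h' : Q <;> simp [ind, h, h']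

section av
variable {X Y Z : Type} [Finite X] [Finite Y] [Finite Z]

lemma av_eq [Fintype X] (f : X → ℝ) : av f = (∑ x, f x) / (Fintype.card X : ℝ) := by
  unfold av
  rw [Nat.card_eq_fintype_card]
  congr!

lemma av_mono {f g : X → ℝ} (h : ∀ x, f x ≤ g x) : av f ≤ av g := by
  cases nonempty_fintype X
  rw [av_eq, av_eq]
  gcongr with x
  exact h x

lemma av_congr {f g : X → ℝ} (h : ∀ x, f x = g x) : av f = av g := by
  rw [funext h]

lemma av_add (f g : X → ℝ) : av (fun x => f x + g x) = av f + av g := by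
  cases nonempty_fintype X
  simp only [av_eq, Finset.sum_add_distrib, add_div]

lemma av_sub (f g : X → ℝ) : av (fun x => f x - g x) = av f - av g := by
  cases nonempty_fintype X
  simp only [av_eq, Finset.sum_sub_distrib, sub_div]

lemma av_mul_left (c : ℝ) (f : X → ℝ) : av (fun x => c * f x) = c * av f := by
  cases nonempty_fintype X
  simp only [av_eq, ← Finset.mul_sum, mul_div_assoc]

lemma av_const [Nonempty X] (c : ℝ) : av (fun _ : X => c) = c := by
  cases nonempty_fintype X
  rw [av_eq]
  have : (Fintype.card X : ℝ) ≠ 0 := by exact_mod_cast Fintype.card_ne_zero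
  simp

lemma av_nonneg {f : X → ℝ} (h : ∀ x, 0 ≤ f x) : 0 ≤ av f := by
  cases nonempty_fintype X
  rw [av_eq]
  exact div_nonneg (Finset.sum_nonneg fun x _ => h x) (by positivity)

lemma av_le [Nonempty X] {f : X → ℝ} {c : ℝ} (h : ∀ x, f x ≤ c) : av f ≤ c :=
  (av_mono h).trans_eq (av_const c)

lemma le_av [Nonempty X] {f : X → ℝ} {c : ℝ} (h : ∀ x, c ≤ f x) : c ≤ av f :=
  (av_const (X := X) c).symm.le.trans (av_mono h)

lemma av_sum {Λ : Type} (s : Finset Λ) (f : Λ → X → ℝ) :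
    av (fun x => ∑ l ∈ s, f l x) = ∑ l ∈ s, av (f l) := by
  cases nonempty_fintype X
  simp only [av_eq]
  rw [Finset.sum_comm, Finset.sum_div]

lemma av_comm (f : X → Y → ℝ) :
    av (fun x => av (fun y => f x y)) = av (fun y => av (fun x => f x y)) := by
  cases nonempty_fintype X
  cases nonempty_fintype Y
  simp only [av_eq, ← Finset.sum_div]
  rw [Finset.sum_comm, div_right_comm]

lemma av_equiv (e : X ≃ Y) (f : Y → ℝ) : av (fun x => f (e x)) = av f := by
  cases nonempty_fintype X
  cases nonempty_fintype Y
  rw [av_eq, av_eq, Fintype.card_congr e, Equiv.sum_comp e f]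

lemma av_prod (f : X × Y → ℝ) : av f = av (fun x => av (fun y => f (x, y))) := by
  cases nonempty_fintype X
  cases nonempty_fintype Y
  simp only [av_eq, ← Finset.sum_div]
  rw [Fintype.sum_prod_type, Fintype.card_prod, div_div]
  push_cast
  rw [mul_comm]

lemma av_range (φ : Z → X) (hφ : Function.Injective φ) (f : X → ℝ) :
    av (fun x => ind (∃ z, φ z = x) * f x) =
      (Nat.card Z : ℝ) / (Nat.card X : ℝ) * av (fun z => f (φ z)) := by
  classical
  cases nonempty_fintype X
  cases nonempty_fintype Z
  rw [av_eq, av_eq, Nat.card_eq_fintype_card, Nat.card_eq_fintype_card]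
  have h1 : ∑ x, ind (∃ z, φ z = x) * f x = ∑ z, f (φ z) := by
    rw [← Finset.sum_image (f := f) (s := univ) (g := φ) (fun a _ b _ h => hφ h)]
    rw [← Finset.sum_subset (Finset.subset_univ (univ.image φ))]
    · apply Finset.sum_congr rfl
      intro x hx
      rw [ind_true (by simpa using hx), one_mul]
    · intro x _ hx
      rw [ind_false (by simpa using hx), zero_mul]
  rw [h1]
  rcases isEmpty_or_nonempty Z with h | h
  · simp
  · have : (Fintype.card Z : ℝ) ≠ 0 := by exact_mod_cast Fintype.card_ne_zero
    field_simp

lemma exists_le_of_le_av [Nonempty X] {f : X → ℝ} {c : ℝ} (h : c ≤ av f) : ∃ x, c ≤ f x := by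
  by_contra hc
  push Not at hc
  cases nonempty_fintype X
  rw [av_eq, le_div_iff₀ (by exact_mod_cast Fintype.card_pos)] at h
  have := Finset.sum_lt_sum_of_nonempty (s := (univ : Finset X)) univ_nonempty fun x _ => hc x
  simp at this
  linarith

/-- if the average is at least `c` and all values are at most `d`, then
each value is at least `d - |X| (d - c)`. -/
lemma av_value_ge {f : X → ℝ} {c c' : ℝ} (h : c ≤ av f) (h' : ∀ x, f x ≤ c') (x : X) :
    c' - Nat.card X * (c' - c) ≤ f x := by
  classical
  cases nonempty_fintype X
  have hX : Nonempty X := ⟨x⟩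
  rw [Nat.card_eq_fintype_card]
  rw [av_eq, le_div_iff₀ (by exact_mod_cast Fintype.card_pos)] at h
  have h1 : ∑ y, (c' - f y) ≥ c' - f x :=
    Finset.single_le_sum (f := fun y => c' - f y) (fun y _ => sub_nonneg.2 (h' y)) (mem_univ x)
  rw [Finset.sum_sub_distrib] at h1
  simp at h1
  nlinarith

end av

lemma av_sumElim {ι κ α : Type} [Finite ι] [Finite κ] [Finite α] (f : (ι ⊕ κ → α) → ℝ) :
    av f = av (fun s : κ → α => av (fun x : ι → α => f (Sum.elim x s))) := by
  rw [av_comm, ← av_prod (fun p : (ι → α) × (κ → α) => f (Sum.elim p.1 p.2)),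
    ← av_equiv (Equiv.sumArrowEquivProdArrow ι κ α).symm]
  rfl

/-- every set of density at least `δ` contains a line -/
def LF (ι α : Type) [Finite ι] [Finite α] (δ : ℝ) : Prop :=
  ∀ A : Set (ι → α), δ ≤ av (fun x => ind (x ∈ A)) → ∃ l : Line α ι, ∀ a, l a ∈ A

/-- density Hales-Jewett for the alphabet -/
def DHJ (α : Type) [Finite α] : Prop :=
  ∀ δ : ℝ, 0 < δ → ∃ (ι : Type) (_ : Finite ι), LF ι α δ

instance lineFinite (α ι : Type) [Finite α] [Finite ι] : Finite (Line α ι) :=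
  Finite.of_injective (fun l => l.idxFun) (fun _ _ h => Line.ext h)

lemma pigeon {X Λ : Type} [Finite X] [Finite Λ] [Nonempty X] (S : Λ → Set X) {δ : ℝ} (hδ : 0 < δ)
    (h : ∀ B : Set X, δ / 2 ≤ av (fun x => ind (x ∈ B)) → ∃ l, S l ⊆ B)
    (Ω : Type) [Finite Ω] [Nonempty Ω] (B : Ω → Set X)
    (hB : δ ≤ av (fun w => av (fun x => ind (x ∈ B w)))) :
    ∃ l, δ / (2 * (Nat.card Λ + 1)) ≤ av (fun w => ind (S l ⊆ B w)) := by
  classical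
  cases nonempty_fintype Λ
  by_contra hc
  push Not at hc
  have h1 : ∀ w, av (fun x => ind (x ∈ B w)) ≤ δ / 2 + ∑ l, ind (S l ⊆ B w) := by
    intro w
    have hn : ∀ l ∈ (univ : Finset Λ), 0 ≤ ind (S l ⊆ B w) := fun l _ => ind_nonneg _
    by_cases hw : δ / 2 ≤ av (fun x => ind (x ∈ B w))
    · obtain ⟨l, hl⟩ := h _ hw
      have := Finset.single_le_sum hn (mem_univ l)
      rw [ind_true hl] at this
      have h2 : av (fun x => ind (x ∈ B w)) ≤ 1 := av_le fun x => ind_le_one _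
      linarith
    · have := Finset.sum_nonneg hn
      linarith
  have h2 := av_mono h1
  rw [av_add, av_const, av_sum] at h2
  have h3 : ∑ l : Λ, av (fun w => ind (S l ⊆ B w)) ≤ ∑ l : Λ, δ / (2 * (Nat.card Λ + 1)) :=
    Finset.sum_le_sum fun l _ => (hc l).le
  rw [Finset.sum_const, Nat.card_eq_fintype_card, Finset.card_univ, nsmul_eq_mul] at h3
  have h4 : (Fintype.card Λ : ℝ) * (δ / (2 * (Fintype.card Λ + 1))) < δ / 2 := by
    have : (0:ℝ) ≤ Fintype.card Λ := by positivity
    rw [← mul_div_assoc, div_lt_div_iff₀ (by positivity) (by positivity)]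
    nlinarith
  linarith

/-- the probabilistic version of density Hales-Jewett -/
lemma prob_dhj {α : Type} [Finite α] [Nonempty α] (H : DHJ α) {δ : ℝ} (hδ : 0 < δ) :
    ∃ (ι : Type) (_ : Finite ι) (Θ : ℝ), 0 < Θ ∧ ∀ (Ω : Type) [Finite Ω] [Nonempty Ω]
      (B : Ω → Set (ι → α)), δ ≤ av (fun w => av (fun x => ind (x ∈ B w))) →
      ∃ l : Line α ι, Θ ≤ av (fun w => ind (∀ a, l a ∈ B w)) := by
  obtain ⟨ι, _, hι⟩ := H (δ / 2) (by positivity)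
  refine ⟨ι, inferInstance, δ / (2 * (Nat.card (Line α ι) + 1)), by positivity, ?_⟩
  intro Ω _ _ B hB
  obtain ⟨l, hl⟩ := pigeon (fun l : Line α ι => Set.range l) hδ (fun B hB => by
    obtain ⟨l, hl⟩ := hι B hB
    exact ⟨l, by rintro _ ⟨a, rfl⟩; exact hl a⟩) Ω B hB
  refine ⟨l, hl.trans (av_mono fun w => ind_mono fun h a => h ⟨a, rfl⟩)⟩

/-- multidimensional density Hales-Jewett -/
lemma mdhj {α : Type} [Finite α] [Nonempty α] (H : DHJ α) (η : Type) [Finite η] :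
    ∀ δ : ℝ, 0 < δ → ∃ (ι : Type) (_ : Finite ι), ∀ A : Set (ι → α),
      δ ≤ av (fun x => ind (x ∈ A)) → ∃ V : Subspace η α ι, ∀ x, V x ∈ A := by
  revert η
  refine Finite.induction_empty_option ?_ ?_ ?_
  · intro η η' e h δ hδ
    obtain ⟨ι, _, hι⟩ := h δ hδ
    refine ⟨ι, inferInstance, fun A hA => ?_⟩
    obtain ⟨V, hV⟩ := hι A hA
    refine ⟨V.reindex e (Equiv.refl _) (Equiv.refl _), fun x => ?_⟩
    have : V.reindex e (Equiv.refl _) (Equiv.refl _) x = V (x ∘ e) := by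
      funext i; rw [Subspace.reindex_apply]; rfl
    rw [this]; exact hV _
  · intro δ hδ
    refine ⟨PEmpty, inferInstance, fun A hA => ?_⟩
    obtain ⟨x, hx⟩ := exists_le_of_le_av hA
    have hxA : x ∈ A := by
      by_contra h
      rw [ind_false h] at hx
      linarith
    refine ⟨⟨fun i => Sum.inl (x i), fun e => e.elim⟩, fun y => ?_⟩
    exact hxA
  · intro η _ ih δ hδ
    obtain ⟨ι₁, _, Θ, hΘ, h1⟩ := prob_dhj H hδ
    obtain ⟨ι₂, _, h2⟩ := ih Θ hΘ
    refine ⟨ι₁ ⊕ ι₂, inferInstance, fun A hA => ?_⟩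
    rw [av_sumElim] at hA
    obtain ⟨l, hl⟩ := h1 (ι₂ → α) (fun s => {x | Sum.elim x s ∈ A}) hA
    obtain ⟨V, hV⟩ := h2 {s | ∀ a, Sum.elim (l a) s ∈ A} hl
    refine ⟨⟨Sum.elim (fun c => (l.idxFun c).elim (Sum.inr none) Sum.inl)
      (fun c => (V.idxFun c).map id some), ?_⟩, fun x => ?_⟩
    · rintro (_ | e)
      · obtain ⟨c, hc⟩ := l.proper
        exact ⟨Sum.inl c, by simp [hc]⟩
      · obtain ⟨c, hc⟩ := V.proper e
        exact ⟨Sum.inr c, by simp [hc]⟩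
    · have := hV (fun e => x (some e)) (x none)
      convert this using 1
      funext c
      rcases c with c | c
      · cases h : l.idxFun c <;> simp [Subspace.coe_apply, h]
      · cases h : V.idxFun c <;> simp [Subspace.coe_apply, h]

/-- Extend a subspace over `α` to words over `Option α`. -/
def wext {η α ι : Type} (W : Subspace η α ι) (y : η → Option α) : ι → Option α :=
  fun c => (W.idxFun c).elim some y

lemma good_bad {α : Type} [Finite α] (ηm : Type) [Finite ηm] (η : Type) [Finite η] :
    ∀ (κ : Type) [Finite κ], ∃ (ι : Type) (_ : Finite ι), ∀ G : κ → Set (ι → Option α),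
      (∃ j, ∃ V : Subspace ηm (Option α) ι, ∀ x, V x ∈ G j) ∨
      (∃ W : Subspace η α ι, ∀ y : η → Option α, (∃ e, y e = none) → ∀ j, wext W y ∉ G j) := by
  revert η
  refine Finite.induction_empty_option ?_ ?_ ?_
  · intro η η' e h κ _
    obtain ⟨ι, _, hι⟩ := h κ
    refine ⟨ι, inferInstance, fun G => ?_⟩
    rcases hι G with h | ⟨W, hW⟩
    · exact Or.inl h
    · refine Or.inr ⟨W.reindex e (Equiv.refl _) (Equiv.refl _), fun y hy j => ?_⟩
      have : wext (W.reindex e (Equiv.refl _) (Equiv.refl _)) y = wext W (y ∘ e) := by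
        funext c
        cases h : W.idxFun c <;> simp [wext, Subspace.reindex, h]
      rw [this]
      apply hW
      obtain ⟨e', he'⟩ := hy
      exact ⟨e.symm e', by simpa using he'⟩
  · intro κ _
    refine ⟨PEmpty, inferInstance, fun G => Or.inr ⟨⟨fun c => c.elim, fun e => e.elim⟩, ?_⟩⟩
    rintro y ⟨e, _⟩
    exact e.elim
  · intro η _ ih κ _
    obtain ⟨ι₁, _, h1⟩ := ih (κ × α)
    obtain ⟨ι', _, h'⟩ := Subspace.exists_mono_in_high_dimension (Option α) (Set κ) (ι₁ ⊕ ηm)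
    refine ⟨Option ι', inferInstance, fun G => ?_⟩
    obtain ⟨V₁, c₀, hV₁⟩ := h' (fun y => {j | (fun c : Option ι' => c.elim none y) ∈ G j})
    by_cases hc : ∃ j, j ∈ c₀
    · obtain ⟨j, hj⟩ := hc
      refine Or.inl ⟨j, ⟨fun c => c.elim (Sum.inl none) (fun c => (V₁.idxFun c).elim Sum.inl
        (fun e => e.elim (fun _ => Sum.inl none) Sum.inr)), ?_⟩, fun x => ?_⟩
      · intro e
        obtain ⟨c, hc⟩ := V₁.proper (Sum.inr e)
        exact ⟨some c, by simp [hc]⟩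
      · rw [← hV₁ (Sum.elim (fun _ => none) x)] at hj
        have hj' : (fun c : Option ι' => c.elim none (V₁ (Sum.elim (fun _ => none) x))) ∈ G j := hj
        convert hj' using 1
        funext c
        rcases c with _ | c
        · simp [Subspace.coe_apply]
        · rcases h : V₁.idxFun c with b | (e | e) <;> simp [Subspace.coe_apply, h]
    · -- the subspace with the new variable
      set u : Option ι' → α ⊕ Option ι₁ := fun c => c.elim (Sum.inr none)
        (fun c => (V₁.idxFun c).elim (fun b => b.elim (Sum.inr none) Sum.inl)
        (fun e => e.elim (fun e => Sum.inr (some e)) (fun _ => Sum.inr none))) with hu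
      have hu0 : u none = Sum.inr none := rfl
      have hu1 : ∀ e, ∃ c, u c = Sum.inr (some e) := by
        intro e
        obtain ⟨c, hc⟩ := V₁.proper (Sum.inl e)
        exact ⟨some c, by simp [hu, hc]⟩
      have hbad : ∀ (x : ι₁ → Option α) (j : κ),
          (fun c => (u c).elim some (fun e => e.elim none x)) ∉ G j := by
        intro x j hj
        apply hc
        refine ⟨j, ?_⟩
        rw [← hV₁ (Sum.elim x (fun _ => none))]
        change (fun c : Option ι' => c.elim none (V₁ (Sum.elim x (fun _ => none)))) ∈ G j
        convert hj using 1
        funext c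
        rcases c with _ | c
        · simp [hu]
        · rcases h : V₁.idxFun c with (_ | b) | (e | e) <;> simp [Subspace.coe_apply, h, hu]
      clear_value u
      rcases h1 (fun p => {x | (fun c => (u c).elim some (fun e => e.elim (some p.2) x)) ∈ G p.1})
        with ⟨⟨j, a⟩, V, hV⟩ | ⟨W, hW⟩
      · refine Or.inl ⟨j, ⟨fun c => (u c).elim (fun b => Sum.inl (some b))
          (fun e => e.elim (Sum.inl (some a)) V.idxFun), ?_⟩, fun x => ?_⟩
        · intro e
          obtain ⟨e', he'⟩ := V.proper e
          obtain ⟨c, hc⟩ := hu1 e'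
          exact ⟨c, by simp [hc, he']⟩
        · have := hV x
          simp only [Set.mem_ofPred_eq] at this
          convert this using 1
          funext c
          rcases h : u c with b | (_ | e) <;> simp [Subspace.coe_apply, h]
      · refine Or.inr ⟨⟨fun c => (u c).elim Sum.inl
          (fun e => e.elim (Sum.inr none) (fun e => (W.idxFun e).map id some)), ?_⟩, ?_⟩
        · rintro (_ | e)
          · exact ⟨none, by simp [hu0]⟩
          · obtain ⟨e', he'⟩ := W.proper e
            obtain ⟨c, hc⟩ := hu1 e'
            exact ⟨c, by simp [hc, he']⟩
        · intro y hy j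
          cases hy0 : y none with
          | none =>
            convert hbad (wext W (fun e => y (some e))) j using 2
            funext c
            rcases h : u c with b | (_ | e)
            · simp [wext, h]
            · simp [wext, h, hy0]
            · cases h' : W.idxFun e <;> simp [wext, h, h']
          | some a =>
            have := hW (fun e => y (some e)) (by
              obtain ⟨e, he⟩ := hy
              rcases e with _ | e
              · rw [hy0] at he; cases he
              · exact ⟨e, he⟩) (j, a)
            simp only [Set.mem_ofPred_eq] at this
            convert this using 2
            funext c
            rcases h : u c with b | (_ | e)
            · simp [wext, h]
            · simp [wext, h, hy0]
            · cases hw : W.idxFun e <;> simp [wext, h, hw]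

/-- `E` is insensitive under exchanging the letters `i` and `none`. -/
def Insens {α ι : Type} (i : α) (E : Set (ι → Option α)) : Prop :=
  ∀ y y' : ι → Option α, (∀ c, (y c).getD i = (y' c).getD i) → y ∈ E → y' ∈ E

lemma Insens.compl {α ι : Type} {i : α} {E : Set (ι → Option α)} (h : Insens i E) :
    Insens i Eᶜ := fun y y' hy hE hE' => hE (h y' y (fun c => (hy c).symm) hE')

lemma av_none_block {ι α : Type} [Finite ι] [Finite α] (b : ℕ) (e : ι) :
    av (fun y : ι × Fin b → Option α => ind (∀ j, y (e, j) = none)) =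
      (1 / (Nat.card α + 1 : ℝ)) ^ b := by
  classical
  cases nonempty_fintype ι
  cases nonempty_fintype α
  have h1 : (univ.filter (fun y : ι × Fin b → Option α => ∀ j, y (e, j) = none)) =
      Fintype.piFinset (fun c : ι × Fin b => if c.1 = e then {none} else univ) := by
    ext y
    simp only [mem_filter, mem_univ, true_and, Fintype.mem_piFinset]
    constructor
    · rintro h ⟨c, j⟩
      by_cases hc : c = e
      · subst hc; simp [h]
      · simp [hc]
    · intro h j
      simpa using h (e, j)
  rw [av_eq]
  have h2 : ∑ y : ι × Fin b → Option α, ind (∀ j, y (e, j) = none) =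
      ((univ.filter (fun y : ι × Fin b → Option α => ∀ j, y (e, j) = none)).card : ℝ) := by
    rw [Finset.card_filter]
    push_cast
    apply Finset.sum_congr rfl
    intro y _
    unfold ind
    congr!
  rw [h2, h1, Fintype.card_piFinset]
  rw [Fintype.card_fun, Fintype.card_prod, Fintype.card_option, Fintype.card_fin, Fintype.prod_prod_type,
    Nat.card_eq_fintype_card]
  have h3 : ∀ x : ι, ∏ y : Fin b, #(if (x, y).1 = e then ({none} : Finset (Option α)) else univ) =
      if x = e then 1 else (Fintype.card α + 1) ^ b := by
    intro x
    by_cases h : x = e <;> simp [h]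
  simp only [h3]
  rw [Finset.prod_ite, Finset.prod_const_one, Finset.prod_const, one_mul]
  have h4 : #{x | ¬ x = e} + 1 = Fintype.card ι := by
    have h5 : (univ.filter fun x : ι => ¬ x = e) = univ.erase e := by ext; simp
    rw [h5, Finset.card_erase_of_mem (mem_univ _), Finset.card_univ]
    have : 0 < Fintype.card ι := Fintype.card_pos_iff.2 ⟨e⟩
    omega
  rw [← h4]
  push_cast
  have h5 : (Fintype.card α + 1 : ℝ) ≠ 0 := by positivity
  rw [div_pow, one_pow, div_eq_div_iff (by positivity) (by positivity)]
  rw [add_mul, pow_add, pow_mul', one_mul, one_mul]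

lemma insens_mdhj {α : Type} [Finite α] [Nonempty α] (H : DHJ α) (i : α) (η : Type) [Finite η]
    {ε : ℝ} (hε : 0 < ε) : ∃ (ι : Type) (_ : Finite ι), ∀ E : Set (ι → Option α), Insens i E →
      ε ≤ av (fun y => ind (y ∈ E)) → ∃ V : Subspace η (Option α) ι, ∀ x, V x ∈ E := by
  classical
  obtain ⟨ι₀, _, h0⟩ := mdhj H η (ε / 2) (by positivity)
  cases nonempty_fintype ι₀
  have hk : (0:ℝ) < Nat.card α := by exact_mod_cast Nat.card_pos
  have hq : (1 / (Nat.card α + 1 : ℝ)) < 1 := by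
    rw [div_lt_one (by positivity)]; linarith
  have hq0 : 0 ≤ (1 / (Nat.card α + 1 : ℝ)) := by positivity
  obtain ⟨b, hb⟩ := exists_pow_lt_of_lt_one (y := (1 / (Nat.card α + 1 : ℝ)))
    (x := (ε / 2) / (Fintype.card ι₀ + 1)) (by positivity) hq
  have hb1 : (1 / (Nat.card α + 1 : ℝ)) ^ (b + 1) < (ε / 2) / (Fintype.card ι₀ + 1) :=
    lt_of_le_of_lt (pow_le_pow_of_le_one hq0 hq.le (Nat.le_succ b)) hb
  refine ⟨ι₀ × Fin (b + 1), inferInstance, fun E hE hEd => ?_⟩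
  set P : (ι₀ × Fin (b + 1) → Option α) → Prop := fun y => ∀ e, ∃ j, y (e, j) ≠ none with hP
  set pos : (ι₀ × Fin (b + 1) → Option α) → ι₀ → Fin (b + 1) :=
    fun y e => Classical.epsilon (fun j => y (e, j) ≠ none) with hpos
  have hpos1 : ∀ y, P y → ∀ e, y (e, pos y e) ≠ none := fun y hy e =>
    Classical.epsilon_spec (hy e)
  set T : (ι₀ × Fin (b + 1) → Option α) → (ι₀ → α) → (ι₀ × Fin (b + 1) → Option α) :=
    fun y z c => if c.2 = pos y c.1 then some (z c.1) else y c with hT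
  have hTn : ∀ y z, P y → ∀ c, T y z c ≠ none ↔ y c ≠ none := by
    rintro y z hy ⟨e, j⟩
    by_cases h : j = pos y e
    · subst h
      simp [hT, hpos1 y hy e]
    · simp [hT, h]
  have hTP : ∀ y z, P y → P (T y z) := fun y z hy e =>
    ⟨pos y e, (hTn y z hy _).2 (hpos1 y hy e)⟩
  have hTpos : ∀ y z, P y → pos (T y z) = pos y := by
    intro y z hy
    funext e
    simp only [hpos]
    congr 1
    funext j
    exact propext (hTn y z hy (e, j))
  set Φ : (ι₀ × Fin (b + 1) → Option α) × (ι₀ → α) → (ι₀ × Fin (b + 1) → Option α) × (ι₀ → α) :=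
    fun p => if P p.1 then (T p.1 p.2, fun e => (p.1 (e, pos p.1 e)).getD i) else p with hΦ
  have hinv : Function.Involutive Φ := by
    rintro ⟨y, z⟩
    by_cases hy : P y
    · have h1 : Φ (y, z) = (T y z, fun e => (y (e, pos y e)).getD i) := by simp [hΦ, hy]
      rw [h1]
      simp only [hΦ, hTP y z hy, if_true, hTpos y z hy]
      ext1
      · funext ⟨e, j⟩
        simp only [hT]
        have := hTpos y z hy
        simp only [hT] at this
        rw [this]
        by_cases h : j = pos y e
        · subst h
          simp only [if_true]
          cases h2 : y (e, pos y e) with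
          | none => exact absurd h2 (hpos1 y hy e)
          | some a => simp
        · simp [h]
      · funext e
        simp [hT]
    · simp [hΦ, hy]
  have hav : av (fun y => ind (y ∈ E)) =
      av (fun y => av (fun z => ind ((Φ (y, z)).1 ∈ E))) := by
    rw [← av_prod (fun p => ind ((Φ p).1 ∈ E))]
    have := av_equiv hinv.toPerm (fun p => ind (p.1 ∈ E))
    simp only [Function.Involutive.coe_toPerm] at this
    rw [this, av_prod]
    simp only [av_const]
  have hex : ∃ y, P y ∧ ε / 2 ≤ av (fun z => ind (T y z ∈ E)) := by
    by_contra hc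
    push Not at hc
    have h1 : ∀ y, av (fun z => ind ((Φ (y, z)).1 ∈ E)) ≤
        ε / 2 + ∑ e, ind (∀ j, y (e, j) = none) := by
      intro y
      have hn : ∀ e ∈ (univ : Finset ι₀), 0 ≤ ind (∀ j, y (e, j) = none) :=
        fun l _ => ind_nonneg _
      by_cases hy : P y
      · have h2 := hc y hy
        have h3 := Finset.sum_nonneg hn
        have h4 : av (fun z => ind ((Φ (y, z)).1 ∈ E)) = av (fun z => ind (T y z ∈ E)) := by
          simp only [hΦ, hy, if_true]
        linarith
      · have hy' := hy
        simp only [hP, not_forall, not_exists, not_not] at hy'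
        obtain ⟨e, he⟩ := hy'
        have := Finset.single_le_sum hn (mem_univ e)
        rw [ind_true he] at this
        have h2 : av (fun z => ind ((Φ (y, z)).1 ∈ E)) ≤ 1 := av_le fun x => ind_le_one _
        linarith
    have h2 := av_mono h1
    rw [← hav, av_add, av_const, av_sum] at h2
    simp only [av_none_block] at h2
    rw [Finset.sum_const, Finset.card_univ, nsmul_eq_mul] at h2
    have h3 : (Fintype.card ι₀ : ℝ) * (1 / (Nat.card α + 1 : ℝ)) ^ (b + 1) < ε / 2 := by
      rw [lt_div_iff₀ (by positivity)] at hb1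
      have : 0 < (1 / (Nat.card α + 1 : ℝ)) ^ (b + 1) := by positivity
      linarith
    linarith
  obtain ⟨y, hy, hyE⟩ := hex
  obtain ⟨V, hV⟩ := h0 {z | T y z ∈ E} hyE
  refine ⟨⟨fun c => if c.2 = pos y c.1 then (V.idxFun c.1).map some id else Sum.inl (y c), ?_⟩, ?_⟩
  · intro e
    obtain ⟨c, hc⟩ := V.proper e
    exact ⟨(c, pos y c), by simp [hc]⟩
  · intro x
    refine hE (T y (V (fun e => (x e).getD i))) _ ?_ (hV _)
    rintro ⟨e, j⟩
    by_cases h : j = pos y e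
    · cases h2 : V.idxFun e <;> simp [hT, h, Subspace.coe_apply, h2]
    · simp [hT, h, Subspace.coe_apply]

lemma subspace_inj {η α ι : Type} (V : Subspace η α ι) :
    Function.Injective (fun x : η → α => V x) := by
  intro x y h
  funext e
  obtain ⟨c, hc⟩ := V.proper e
  have := congrFun h c
  simpa [Subspace.coe_apply, hc] using this

/-- composition of subspaces -/
def scomp {η η' α ι : Type} (V : Subspace η' α ι) (U : Subspace η α η') : Subspace η α ι where
  idxFun c := (V.idxFun c).elim Sum.inl U.idxFun
  proper e := by
    obtain ⟨e', he'⟩ := U.proper e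
    obtain ⟨c, hc⟩ := V.proper e'
    exact ⟨c, by simp [hc, he']⟩

lemma scomp_apply {η η' α ι : Type} (V : Subspace η' α ι) (U : Subspace η α η') (x : η → α) :
    scomp V U x = V (U x) := by
  funext c
  cases h : V.idxFun c <;> simp [Subspace.coe_apply, scomp, h]

def shor {η α ι κ : Type} (V : Subspace η α ι) (s : κ → α) : Subspace η α (ι ⊕ κ) where
  idxFun := Sum.elim V.idxFun (fun c => Sum.inl (s c))
  proper e := by
    obtain ⟨c, hc⟩ := V.proper e
    exact ⟨Sum.inl c, by simp [hc]⟩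

lemma shor_apply {η α ι κ : Type} (V : Subspace η α ι) (s : κ → α) (x : η → α) :
    shor V s x = Sum.elim (V x) s := by
  funext c
  rcases c with c | c <;> simp [Subspace.coe_apply, shor]

def sver {η α ι κ : Type} (s : ι → α) (V : Subspace η α κ) : Subspace η α (ι ⊕ κ) where
  idxFun := Sum.elim (fun c => Sum.inl (s c)) V.idxFun
  proper e := by
    obtain ⟨c, hc⟩ := V.proper e
    exact ⟨Sum.inr c, by simp [hc]⟩

lemma sver_apply {η α ι κ : Type} (s : ι → α) (V : Subspace η α κ) (x : η → α) :
    sver s V x = Sum.elim s (V x) := by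
  funext c
  rcases c with c | c <;> simp [Subspace.coe_apply, sver]

/-- removal of one subspace from each heavy insensitive set -/
lemma removal {α : Type} [Finite α] [Nonempty α] (H : DHJ α) (i : α) (η : Type) [Finite η]
    {ε : ℝ} (hε : 0 < ε) : ∃ (ι : Type) (_ : Finite ι) (c : ℝ), 0 < c ∧ c ≤ 1 ∧
      ∃ R : Set (ι → Option α) → Set (ι → Option α), (∀ S, R S ⊆ S) ∧
      (∀ S, Insens i S → c * (av (fun y => ind (y ∈ S)) - ε) ≤ av (fun y => ind (y ∈ R S))) ∧
      (∀ S (g : (ι → Option α) → ℝ) (θ : ℝ),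
        (∀ V : Subspace η (Option α) ι, av (fun x => g (V x)) ≤ θ) →
        av (fun y => ind (y ∈ R S) * g y) ≤ θ * av (fun y => ind (y ∈ R S))) := by
  classical
  obtain ⟨ι, _, hι⟩ := insens_mdhj H i η hε
  set c₀ : ℝ := (Nat.card (η → Option α) : ℝ) / (Nat.card (ι → Option α) : ℝ) with hc₀
  have hc₀pos : 0 < c₀ := by
    have h1 : (0:ℝ) < Nat.card (η → Option α) := by exact_mod_cast Nat.card_pos
    have h2 : (0:ℝ) < Nat.card (ι → Option α) := by exact_mod_cast Nat.card_pos
    positivity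
  let R : Set (ι → Option α) → Set (ι → Option α) := fun S =>
    {x | ∃ h : (∃ V : Subspace η (Option α) ι, ∀ x, V x ∈ S), ∃ z, h.choose z = x}
  have hR0 : ∀ S, (¬ ∃ V : Subspace η (Option α) ι, ∀ x, V x ∈ S) → ∀ y, ind (y ∈ R S) = 0 := by
    intro S h y
    exact ind_false fun ⟨h', _⟩ => h h'
  have hR1 : ∀ S (h : ∃ V : Subspace η (Option α) ι, ∀ x, V x ∈ S) (g : (ι → Option α) → ℝ),
      av (fun y => ind (y ∈ R S) * g y) = c₀ * av (fun z => g (h.choose z)) := by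
    intro S h g
    rw [← av_range _ (subspace_inj h.choose) g]
    apply av_congr
    intro y
    congr 1
    exact ind_congr ⟨fun ⟨_, h⟩ => h, fun h' => ⟨h, h'⟩⟩
  have hR2 : ∀ S (h : ∃ V : Subspace η (Option α) ι, ∀ x, V x ∈ S),
      av (fun y => ind (y ∈ R S)) = c₀ := by
    intro S h
    have := hR1 S h (fun _ => 1)
    simpa [av_const] using this
  refine ⟨ι, inferInstance, min c₀ 1, lt_min hc₀pos one_pos, min_le_right _ _, R, ?_, ?_, ?_⟩
  · rintro S _ ⟨h, z, rfl⟩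
    exact h.choose_spec z
  · intro S hS
    have hm : 0 < min c₀ 1 := lt_min hc₀pos one_pos
    by_cases h : ∃ V : Subspace η (Option α) ι, ∀ x, V x ∈ S
    · rw [hR2 S h]
      have h1 : av (fun y => ind (y ∈ S)) ≤ 1 := av_le fun y => ind_le_one _
      have h2 : min c₀ 1 ≤ c₀ := min_le_left _ _
      nlinarith
    · have h1 : av (fun y => ind (y ∈ S)) < ε := by
        by_contra hc
        exact h (hι S hS (not_lt.1 hc))
      have h2 : 0 ≤ av (fun y => ind (y ∈ R S)) := av_nonneg fun y => ind_nonneg _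
      nlinarith
  · intro S g θ hg
    by_cases h : ∃ V : Subspace η (Option α) ι, ∀ x, V x ∈ S
    · rw [hR1 S h, hR2 S h, mul_comm θ]
      exact mul_le_mul_of_nonneg_left (hg _) hc₀pos.le
    · simp only [hR0 S h, zero_mul]
      simp [av_const]

lemma tile_aux {α : Type} [Finite α] [Nonempty α] (H : DHJ α) (i : α) (η : Type) [Finite η]
    {ε : ℝ} (hε : 0 < ε) : ∃ c : ℝ, 0 < c ∧ c ≤ 1 ∧ ∀ q : ℕ, ∃ (ι : Type) (_ : Finite ι),
      ∀ f : (ι → Option α) → ℝ, (∀ y, f y ≤ 1) → ∀ θ : ℝ, 0 ≤ θ →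
      (∀ V : Subspace η (Option α) ι, av (fun x => f (V x)) ≤ θ) →
      ∀ E : Set (ι → Option α), Insens i E → av (fun y => ind (y ∈ E) * f y) ≤
        θ * av (fun y => ind (y ∈ E)) + ε + (1 - c) ^ q * (av (fun y => ind (y ∈ E)) - ε) := by
  classical
  obtain ⟨ι₁, _, c, hc, hc1, R, hR1, hR2, hR3⟩ := removal H i η hε
  refine ⟨c, hc, hc1, fun q => ?_⟩
  induction q with
  | zero =>
    refine ⟨PEmpty, inferInstance, fun f hf θ hθ hV E hE => ?_⟩
    have h1 : av (fun y => ind (y ∈ E) * f y) ≤ av (fun y => ind (y ∈ E)) :=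
      av_mono fun y => mul_le_of_le_one_right (ind_nonneg _) (hf y)
    have h2 : 0 ≤ av (fun y => ind (y ∈ E)) := av_nonneg fun y => ind_nonneg _
    have := mul_nonneg hθ h2
    simp only [pow_zero]
    linarith
  | succ q ih =>
    obtain ⟨ι₂, _, h2⟩ := ih
    refine ⟨ι₁ ⊕ ι₂, inferInstance, fun f hf θ hθ hV E hE => ?_⟩
    set F : (ι₂ → Option α) → Set (ι₁ → Option α) := fun s => {x | Sum.elim x s ∈ E} with hF
    set E' : (ι₁ → Option α) → Set (ι₂ → Option α) :=
      fun x => {s | Sum.elim x s ∈ E ∧ x ∉ R (F s)} with hE'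
    have hFins : ∀ s, Insens i (F s) := by
      intro s y y' hy h
      refine hE (Sum.elim y s) (Sum.elim y' s) ?_ h
      rintro (c | c)
      · exact hy c
      · rfl
    have hFeq : ∀ s s' : ι₂ → Option α, (∀ c, (s c).getD i = (s' c).getD i) → F s ⊆ F s' := by
      intro s s' hs x hx
      refine hE (Sum.elim x s) (Sum.elim x s') ?_ hx
      rintro (c | c)
      · rfl
      · exact hs c
    have hEins : ∀ x, Insens i (E' x) := by
      intro x s s' hs h
      have h1 : F s = F s' := (hFeq s s' hs).antisymm (hFeq s' s fun c => (hs c).symm)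
      refine ⟨hFeq s s' hs h.1, ?_⟩
      rw [← h1]; exact h.2
    have hsplit : ∀ x s, ind (Sum.elim x s ∈ E) = ind (x ∈ R (F s)) + ind (s ∈ E' x) := by
      intro x s
      by_cases h : x ∈ R (F s)
      · rw [ind_true h, ind_true (show Sum.elim x s ∈ E from hR1 _ h), ind_false (fun h' => h'.2 h)]; norm_num
      · rw [ind_false h, zero_add]
        exact ind_congr ⟨fun h' => ⟨h', h⟩, fun h' => h'.1⟩
    set r := av (fun s => av (fun x => ind (x ∈ R (F s)))) with hr
    set e' := av (fun x => av (fun s => ind (s ∈ E' x))) with he'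
    have he : av (fun y => ind (y ∈ E)) = r + e' := by
      rw [av_sumElim]
      simp only [hsplit, av_add]
      rw [hr, he', av_comm (fun x s => ind (s ∈ E' x))]
    have h3 : av (fun y => ind (y ∈ E) * f y) =
        av (fun s => av (fun x => ind (x ∈ R (F s)) * f (Sum.elim x s))) +
        av (fun x => av (fun s => ind (s ∈ E' x) * f (Sum.elim x s))) := by
      rw [av_sumElim]
      simp only [hsplit, add_mul, av_add]
      rw [av_comm (fun x s => ind (s ∈ E' x) * f (Sum.elim x s))]
    have h4 : av (fun s => av (fun x => ind (x ∈ R (F s)) * f (Sum.elim x s))) ≤ θ * r := by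
      rw [hr, ← av_mul_left]
      refine av_mono fun s => hR3 (F s) (fun x => f (Sum.elim x s)) θ fun V => ?_
      have := hV (shor V s)
      simpa only [shor_apply] using this
    have h5 : av (fun x => av (fun s => ind (s ∈ E' x) * f (Sum.elim x s))) ≤
        θ * e' + ε + (1 - c) ^ q * (e' - ε) := by
      have : ∀ x, av (fun s => ind (s ∈ E' x) * f (Sum.elim x s)) ≤
          θ * av (fun s => ind (s ∈ E' x)) + ε +
            (1 - c) ^ q * (av (fun s => ind (s ∈ E' x)) - ε) := by
        intro x
        refine h2 (fun s => f (Sum.elim x s)) (fun s => hf _) θ hθ (fun V => ?_) (E' x) (hEins x)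
        have := hV (sver x V)
        simpa only [sver_apply] using this
      refine (av_mono this).trans_eq ?_
      rw [av_add, av_add, av_mul_left, av_mul_left, av_sub, av_const]
    have h6 : c * (av (fun y => ind (y ∈ E)) - ε) ≤ r := by
      have := av_mono (fun s => hR2 (F s) (hFins s))
      rw [av_mul_left, av_sub, av_const] at this
      rw [av_sumElim]
      exact this
    rw [h3, he]
    rw [he] at h6
    have h7 : 0 ≤ (1 - c) ^ q := pow_nonneg (by linarith) q
    have h8 : (1 - c) ^ q * (e' - ε) ≤ (1 - c) ^ q * ((1 - c) * (r + e' - ε)) :=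
      mul_le_mul_of_nonneg_left (by linarith) h7
    rw [pow_succ, mul_assoc]
    linarith

lemma tile_one {α : Type} [Finite α] [Nonempty α] (H : DHJ α) (i : α) (η : Type) [Finite η]
    {ε : ℝ} (hε : 0 < ε) : ∃ (ι : Type) (_ : Finite ι),
      ∀ f : (ι → Option α) → ℝ, (∀ y, f y ≤ 1) → ∀ θ : ℝ, 0 ≤ θ →
      (∀ V : Subspace η (Option α) ι, av (fun x => f (V x)) ≤ θ) →
      ∀ E : Set (ι → Option α), Insens i E → av (fun y => ind (y ∈ E) * f y) ≤ θ + ε := by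
  obtain ⟨c, hc, hc1, h⟩ := tile_aux H i η (half_pos hε)
  obtain ⟨q, hq⟩ := exists_pow_lt_of_lt_one (half_pos hε) (show 1 - c < 1 by linarith)
  obtain ⟨ι, _, hι⟩ := h q
  refine ⟨ι, inferInstance, fun f hf θ hθ hV E hE => (hι f hf θ hθ hV E hE).trans ?_⟩
  have h1 : av (fun y => ind (y ∈ E)) ≤ 1 := av_le fun y => ind_le_one _
  have h2 : 0 ≤ (1 - c) ^ q := pow_nonneg (by linarith) q
  have h3 : θ * av (fun y => ind (y ∈ E)) ≤ θ := mul_le_of_le_one_right hθ h1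
  have h4 : (1 - c) ^ q * (av (fun y => ind (y ∈ E)) - ε / 2) ≤ (1 - c) ^ q :=
    mul_le_of_le_one_right h2 (by linarith)
  linarith

lemma tile_many {α : Type} [Finite α] [Nonempty α] (H : DHJ α) (s : Finset α) :
    ∀ (η : Type) [Finite η] (ε : ℝ), 0 < ε → ∃ (ι : Type) (_ : Finite ι),
      ∀ f : (ι → Option α) → ℝ, (∀ y, f y ≤ 1) → ∀ θ : ℝ, 0 ≤ θ →
      (∀ V : Subspace η (Option α) ι, av (fun x => f (V x)) ≤ θ) →
      ∀ D : α → Set (ι → Option α), (∀ i, Insens i (D i)) →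
      av (fun y => ind (∀ i ∈ s, y ∈ D i) * f y) ≤ θ + ε := by
  classical
  induction s using Finset.induction_on with
  | empty =>
    intro η _ ε hε
    refine ⟨η, inferInstance, fun f hf θ hθ hV D hD => ?_⟩
    have h1 := hV default
    have h2 : ∀ x : η → Option α, (default : Subspace η (Option α) η) x = x := fun x => rfl
    simp only [h2] at h1
    simp only [ind_true (show ∀ i ∈ (∅ : Finset α), _ from fun i hi => absurd hi (by simp)), one_mul]
    linarith
  | insert a s ha ih =>
    intro η _ ε hε
    obtain ⟨ι', _, h1⟩ := ih η (ε / 2) (half_pos hε)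
    obtain ⟨ι, _, h2⟩ := tile_one H a ι' (half_pos hε)
    refine ⟨ι, inferInstance, fun f hf θ hθ hV D hD => ?_⟩
    have h3 := h2 (fun y => ind (∀ i ∈ s, y ∈ D i) * f y) (fun y => ?_) (θ + ε / 2) (by positivity)
      (fun V => ?_) (D a) (hD a)
    · calc av (fun y => ind (∀ i ∈ insert a s, y ∈ D i) * f y) =
          av (fun y => ind (y ∈ D a) * (ind (∀ i ∈ s, y ∈ D i) * f y)) := by
            apply av_congr
            intro y
            rw [← mul_assoc, ← ind_and]
            simp only [Finset.forall_mem_insert]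
        _ ≤ θ + ε / 2 + ε / 2 := h3
        _ = θ + ε := by ring
    · by_cases h : ∀ i ∈ s, y ∈ D i
      · rw [ind_true h, one_mul]; exact hf y
      · rw [ind_false h, zero_mul]; norm_num
    · refine h1 (fun x => f (V x)) (fun x => hf _) θ hθ (fun U => ?_) (fun i => {x | V x ∈ D i}) ?_
      · have := hV (scomp V U)
        simpa only [scomp_apply] using this
      · intro i y y' hy h
        refine hD i (V y) (V y') (fun c => ?_) h
        cases hc : V.idxFun c <;> simp [Subspace.coe_apply, hc, hy]

lemma tile_compl {α : Type} [Fintype α] [Nonempty α] (H : DHJ α)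
    (η : Type) [Finite η] (ε : ℝ) (hε : 0 < ε) : ∃ (ι : Type) (_ : Finite ι),
      ∀ f : (ι → Option α) → ℝ, (∀ y, f y ≤ 1) →
      (∀ V : Subspace η (Option α) ι, av (fun x => f (V x)) ≤ 0) →
      ∀ D : α → Set (ι → Option α), (∀ i, Insens i (D i)) →
      av (fun y => (1 - ind (∀ i, y ∈ D i)) * f y) ≤ Fintype.card α * ε := by
  classical
  obtain ⟨ι, _, h⟩ := tile_many H (univ : Finset α) η ε hε
  refine ⟨ι, inferInstance, fun f hf hV D hD => ?_⟩
  have key : ∀ s : Finset α, av (fun y => (1 - ind (∀ i ∈ s, y ∈ D i)) * f y) ≤ s.card * ε := by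
    intro s
    induction s using Finset.induction_on with
    | empty =>
      simp only [ind_true (show ∀ i ∈ (∅ : Finset α), _ from fun i hi => absurd hi (by simp)),
        sub_self, zero_mul]
      simp [av_const]
    | insert a s ha ih =>
      have h1 := h f hf 0 le_rfl hV
        (fun i => if i = a then (D a)ᶜ else if i ∈ s then D i else Set.univ) (by
          intro i
          by_cases h1 : i = a
          · subst h1; simpa using (hD i).compl
          · by_cases h2 : i ∈ s
            · simpa [h1, h2] using hD i
            · simp only [h1, h2, if_false]
              intro _ _ _ _; trivial)
      have h2 : ∀ y, (1 - ind (∀ i ∈ insert a s, y ∈ D i)) * f y =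
          (1 - ind (∀ i ∈ s, y ∈ D i)) * f y + ind (∀ i ∈ (univ : Finset α), y ∈
            (fun i => if i = a then (D a)ᶜ else if i ∈ s then D i else Set.univ) i) * f y := by
        intro y
        rw [← add_mul]
        congr 1
        have h3 : ind (∀ i ∈ insert a s, y ∈ D i) = ind (y ∈ D a) * ind (∀ i ∈ s, y ∈ D i) := by
          rw [← ind_and]; simp only [Finset.forall_mem_insert]
        have h4 : ind (∀ i ∈ (univ : Finset α), y ∈
            (fun i => if i = a then (D a)ᶜ else if i ∈ s then D i else Set.univ) i) =
            ind (¬ y ∈ D a) * ind (∀ i ∈ s, y ∈ D i) := by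
          rw [← ind_and]
          apply ind_congr
          constructor
          · intro h
            refine ⟨by simpa using h a (mem_univ _), fun i hi => ?_⟩
            have hia : i ≠ a := fun h => ha (h ▸ hi)
            simpa [hia, hi] using h i (mem_univ _)
          · rintro ⟨h1, h2⟩ i _
            by_cases hia : i = a
            · simpa [hia] using h1
            · by_cases his : i ∈ s
              · simpa [hia, his] using h2 i his
              · simp [hia, his]
        rw [h3, h4, ind_not]
        ring
      rw [av_congr h2, av_add, Finset.card_insert_of_notMem ha]
      push_cast
      linarith
  have := key univ
  simpa using this


lemma lcomp {η α ι : Type} (V : Subspace η α ι) (l : Line α η) :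
    ∃ l' : Line α ι, ∀ a, l' a = V (l a) := by
  refine ⟨⟨fun c => (V.idxFun c).elim some l.idxFun, ?_⟩, ?_⟩
  · obtain ⟨e, he⟩ := l.proper
    obtain ⟨c, hc⟩ := V.proper e
    exact ⟨c, by simp [hc, he]⟩
  · intro a
    funext c
    rw [Line.coe_apply, Subspace.coe_apply]
    cases h : V.idxFun c <;> simp [h, Line.coe_apply]

lemma LF.mono {ι α : Type} [Finite ι] [Finite α] {d d' : ℝ} (h : LF ι α d) (hd : d ≤ d') :
    LF ι α d' := fun A hA => h A (hd.trans hA)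

lemma crit {β : Type} [Finite β] (hn : ¬ DHJ β) : ∃ δ : ℝ, 0 < δ ∧
    (∀ ε > 0, ∃ (ι : Type) (_ : Finite ι), LF ι β (δ + ε)) ∧
    (∀ d < δ, ∀ (ι : Type) [Finite ι], ¬ LF ι β d) := by
  unfold DHJ at hn
  push Not at hn
  obtain ⟨δ0, h0, hn⟩ := hn
  set S : Set ℝ := {d | ∃ (ι : Type) (_ : Finite ι), LF ι β d} with hS
  have hlb : ∀ d ∈ S, δ0 ≤ d := by
    rintro d ⟨ι, hι, hd⟩
    by_contra h
    exact hn ι hι (hd.mono (not_le.1 h).le)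
  have hne : S.Nonempty := by
    refine ⟨2, Unit, inferInstance, fun A hA => ?_⟩
    exfalso
    by_cases hb : Nonempty (Unit → β)
    · have : av (fun x : Unit → β => ind (x ∈ A)) ≤ 1 := av_le fun x => ind_le_one _
      linarith
    · have : IsEmpty (Unit → β) := not_nonempty_iff.1 hb
      have : av (fun x : Unit → β => ind (x ∈ A)) = 0 := by
        unfold av; simp
      linarith
  have hbd : BddBelow S := ⟨δ0, hlb⟩
  refine ⟨sInf S, h0.trans_le (le_csInf hne hlb), ?_, ?_⟩
  · intro ε hε
    obtain ⟨d, ⟨ι, hι, hd⟩, hlt⟩ := exists_lt_of_csInf_lt hne (lt_add_of_pos_right (sInf S) hε)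
    exact ⟨ι, hι, hd.mono hlt.le⟩
  · intro d hd ι hι h
    exact absurd (csInf_le hbd ⟨ι, hι, h⟩) (not_le.2 hd)

lemma dhj_step {α : Type} [Finite α] [Nonempty α] (H : DHJ α) : DHJ (Option α) := by
  classical
  cases nonempty_fintype α
  by_contra hn
  obtain ⟨δ, hδ, hup, hlow⟩ := crit hn
  obtain ⟨ι0, _, Θ, hΘ, hprob⟩ := prob_dhj H (half_pos hδ)
  set k : ℝ := (Fintype.card α : ℝ) with hk
  have hk0 : 0 ≤ k := by positivity
  set ε : ℝ := min (δ / 2) (δ * Θ / (k + 3)) with hεdef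
  have hε : 0 < ε := by
    apply lt_min <;> positivity
  have hε1 : ε ≤ δ / 2 := min_le_left _ _
  have hε2 : ε * (k + 3) ≤ δ * Θ := by
    rw [← le_div_iff₀ (by positivity)]; exact min_le_right _ _
  obtain ⟨ιd, _, hd⟩ := hup ε hε
  obtain ⟨ιm, _, hm⟩ := tile_compl H ιd ε hε
  obtain ⟨ιM, _, hM⟩ := good_bad (α := α) ιm ι0 Unit
  set K : ℝ := (Nat.card (ιM → Option α) : ℝ) with hK
  have hK0 : 1 ≤ K := by
    have : 0 < Nat.card (ιM → Option α) := Nat.card_pos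
    rw [hK]; exact_mod_cast (show 1 ≤ Nat.card (ιM → Option α) from this)
  set η' : ℝ := ε / (2 * K) with hη'
  have hη0 : 0 < η' := by positivity
  have hηK : K * (2 * η') = ε := by rw [hη']; field_simp
  obtain ⟨ιN, _, hN⟩ := hup η' hη0
  have hnot := hlow (δ - η') (by linarith) (ιM ⊕ ιN)
  unfold LF at hnot
  push Not at hnot
  obtain ⟨A, hA, hfree⟩ := hnot
  have hfree' : ∀ l : Line (Option α) (ιM ⊕ ιN), ¬ ∀ a, l a ∈ A := by
    intro l h
    obtain ⟨a, ha⟩ := hfree l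
    exact ha (h a)
  -- fibers
  have hfib : ∀ t : ιM → Option α, δ - ε ≤ av (fun s : ιN → Option α => ind (Sum.elim t s ∈ A)) := by
    intro t
    rw [av_sumElim, av_comm] at hA
    have hle : ∀ t : ιM → Option α,
        av (fun s : ιN → Option α => ind (Sum.elim t s ∈ A)) ≤ δ + η' := by
      intro t
      by_contra h
      obtain ⟨l, hl⟩ := hN {s | Sum.elim t s ∈ A} (not_le.1 h).le
      refine hfree' (l.vertical t) fun a => ?_
      rw [Line.vertical_apply]
      exact hl a
    have := av_value_ge hA hle t
    have e1 : (δ + η') - K * ((δ + η') - (δ - η')) = δ + η' - ε := by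
      rw [← hηK]; ring
    linarith
  set G : Set (ιM → Option α) := {t | (∃ c, t c = none) ∧
    Θ ≤ av (fun s : ιN → Option α => ind (∀ a : α,
      Sum.elim (fun c => some ((t c).getD a)) s ∈ A))} with hG
  have hV : ∃ V : Subspace ιm (Option α) ιM, ∀ x, V x ∈ G := by
    rcases hM (fun _ => G) with ⟨_, V, hV⟩ | ⟨W, hW⟩
    · exact ⟨V, hV⟩
    exfalso
    obtain ⟨l, hl⟩ := hprob (ιN → Option α) (fun s => {x | Sum.elim (fun c => some (W x c)) s ∈ A}) (by
      rw [av_comm]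
      refine le_av fun x => ?_
      refine le_trans ?_ (hfib _)
      linarith)
    refine hW l.idxFun l.proper () ⟨?_, ?_⟩
    · obtain ⟨e, he⟩ := l.proper
      obtain ⟨c, hc⟩ := W.proper e
      exact ⟨c, by simp [wext, hc, he]⟩
    · refine hl.trans (av_mono fun s => ind_mono fun h a => ?_)
      have := h a
      convert (show Sum.elim (fun c => some (W (l a) c)) s ∈ A from this) using 3
      rename_i c
      rw [Subspace.coe_apply]
      cases h : W.idxFun c <;> simp [wext, h, Line.coe_apply]
  obtain ⟨V, hV⟩ := hV
  have key : ∀ s : ιN → Option α, av (fun x : ιm → Option α => ind (Sum.elim (V x) s ∈ A)) ≤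
      k * ε + (δ + ε) * (1 - av (fun x : ιm → Option α =>
        ind (∀ a : α, Sum.elim (fun c => some ((V x c).getD a)) s ∈ A))) := by
    intro s
    set D : α → Set (ιm → Option α) :=
      fun a => {x | Sum.elim (fun c => some ((V x c).getD a)) s ∈ A} with hD
    have h1 := hm (fun x => ind (Sum.elim (V x) s ∈ A) - (δ + ε))
      (fun x => by have := ind_le_one (Sum.elim (V x) s ∈ A); linarith)
      (fun U => by
        rw [av_sub, av_const, sub_nonpos]
        by_contra h
        obtain ⟨l, hl⟩ := hd {x | Sum.elim (V (U x)) s ∈ A} (not_le.1 h).le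
        obtain ⟨l1, hl1⟩ := lcomp U l
        obtain ⟨l2, hl2⟩ := lcomp V l1
        refine hfree' (l2.horizontal s) fun a => ?_
        rw [Line.horizontal_apply, hl2, hl1]
        exact hl a) D
      (fun a y y' hyy hy => by
        have : (fun c => some ((V y' c).getD a)) = (fun c => some ((V y c).getD a)) := by
          funext c
          rw [Subspace.coe_apply, Subspace.coe_apply]
          cases h : V.idxFun c
          · simp
          · simp [hyy]
        show Sum.elim (fun c => some ((V y' c).getD a)) s ∈ A
        rw [this]; exact hy)
    have h2 : ∀ x : ιm → Option α, (1 - ind (∀ i, x ∈ D i)) *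
        (ind (Sum.elim (V x) s ∈ A) - (δ + ε)) =
        ind (Sum.elim (V x) s ∈ A) - (δ + ε) * (1 - ind (∀ i, x ∈ D i)) := by
      intro x
      by_cases hx : ∀ i, x ∈ D i
      · have hx' : ¬ Sum.elim (V x) s ∈ A := by
          intro hx'
          obtain ⟨c, hc⟩ := (hV x).1
          let l : Line (Option α) ιM := ⟨fun c => (V x c).elim none (fun b => some (some b)),
            ⟨c, by simp [hc]⟩⟩
          refine hfree' (l.horizontal s) fun a => ?_
          rw [Line.horizontal_apply]
          cases a with
          | none =>
            convert hx' using 2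
            funext c
            rw [Line.coe_apply]
            cases h : V x c <;> simp [l, h]
          | some a =>
            have := hx a
            simp only [hD] at this
            convert (show Sum.elim (fun c => some ((V x c).getD a)) s ∈ A from this) using 2
            funext c
            rw [Line.coe_apply]
            cases h : V x c <;> simp [l, h]
        rw [ind_true hx, ind_false hx']; ring
      · rw [ind_false hx]; ring
    rw [av_congr h2, av_sub, av_mul_left, av_sub, av_const] at h1
    have h3 : av (fun x : ιm → Option α => ind (∀ i, x ∈ D i)) = av (fun x : ιm → Option α =>
        ind (∀ a : α, Sum.elim (fun c => some ((V x c).getD a)) s ∈ A)) := rfl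
    rw [← h3]
    linarith
  have h1 := av_mono key
  rw [av_comm, av_add, av_const, av_mul_left, av_sub, av_const] at h1
  have h4 := av_comm (fun (s : ιN → Option α) (x : ιm → Option α) =>
      ind (∀ a : α, Sum.elim (fun c => some ((V x c).getD a)) s ∈ A))
  rw [h4] at h1
  have h2 : δ - ε ≤ av (fun x : ιm → Option α => av (fun s : ιN → Option α =>
      ind (Sum.elim (V x) s ∈ A))) := le_av fun x => hfib _
  have h3 : Θ ≤ av (fun x : ιm → Option α => av (fun s : ιN → Option α =>
      ind (∀ a : α, Sum.elim (fun c => some ((V x c).getD a)) s ∈ A))) := le_av fun x => (hV x).2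
  nlinarith [mul_le_mul_of_nonneg_left h3 (show 0 ≤ δ + ε by linarith), mul_pos hε hΘ]

lemma dhj (α : Type) [Finite α] : DHJ α := by
  suffices h : ∀ (α : Type) [Finite α], ∀ _ : Finite α, DHJ α from h α inferInstance
  refine Finite.induction_empty_option ?_ ?_ ?_
  · intro α β e h _
    have : Finite α := Finite.of_equiv β e.symm
    intro δ hδ
    obtain ⟨ι, _, hι⟩ := h inferInstance δ hδ
    refine ⟨ι, inferInstance, fun A hA => ?_⟩
    obtain ⟨l, hl⟩ := hι {x | e ∘ x ∈ A} (by
      rw [← av_equiv (Equiv.arrowCongr (Equiv.refl ι) e)] at hA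
      exact hA)
    refine ⟨l.map e, fun b => ?_⟩
    have := hl (e.symm b)
    have h2 := Line.map_apply e l (e.symm b)
    rw [e.apply_symm_apply] at h2
    rw [h2]; exact this
  · intro _ δ hδ
    exact ⟨Unit, inferInstance, fun A hA => ⟨⟨fun _ => none, (), rfl⟩, fun a => a.elim⟩⟩
  · intro α _ h _
    by_cases hα : Nonempty α
    · have := Finite.of_fintype α
      exact dhj_step (h inferInstance)
    · have : IsEmpty α := not_nonempty_iff.1 hα
      intro δ hδ
      refine ⟨Unit, inferInstance, fun A hA => ?_⟩
      obtain ⟨x, hx⟩ := exists_le_of_le_av hA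
      have hxA : x ∈ A := by
        by_contra h
        rw [ind_false h] at hx
        linarith
      refine ⟨⟨fun _ => none, (), rfl⟩, fun a => ?_⟩
      convert hxA using 1
      exact Subsingleton.elim _ _

lemma sum_line {k : ℕ} {ι : Type} [Fintype ι] (l : Line (Fin (k + 1)) ι) (j : Fin (k + 1)) :
    (∑ c, ((l j c : Fin (k + 1)) : ℚ)) =
      (∑ c, ((l 0 c : Fin (k + 1)) : ℚ)) + (j : ℚ) * ((Finset.univ.filter fun c => l.idxFun c = none).card : ℚ) := by
  rw [Finset.card_filter, Nat.cast_sum, Finset.mul_sum, ← Finset.sum_add_distrib]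
  refine Finset.sum_congr rfl fun c _ => ?_
  rw [Line.coe_apply, Line.coe_apply]
  cases h : l.idxFun c <;> simp

lemma exists_shift {W : Type} [Finite W] [Nonempty W] (φ : W → ℚ) (F : ℕ → Finset ℚ)
    (hF : IsLeftFolner F) (A : Set ℚ) (hA : 0 < upperDensity F A) :
    ∃ g : ℚ, upperDensity F A / 4 ≤ av (fun w => ind (g + φ w ∈ A)) := by
  classical
  cases nonempty_fintype W
  set δ := upperDensity F A with hδ
  have hbd : Filter.IsCoboundedUnder (· ≤ ·) Filter.atTop
      (fun n => (Set.ncard (A ∩ ↑(F n)) : ℝ) / (F n).card) :=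
    Filter.isCoboundedUnder_le_of_le Filter.atTop (x := 0) fun n => by positivity
  have hfr := Filter.frequently_lt_of_lt_limsup hbd
    (show δ / 2 < Filter.limsup (fun n => (Set.ncard (A ∩ ↑(F n)) : ℝ) / (F n).card) Filter.atTop by
      change δ / 2 < δ; linarith)
  have hev : ∀ᶠ n in Filter.atTop, ∀ w : W,
      ((((F n).image (φ w + ·)) ∆ (F n)).card : ℝ) / (F n).card < δ / 4 :=
    Filter.eventually_all.2 fun w => (hF.2 (φ w)).eventually_lt_const (by linarith)
  obtain ⟨n, hn1, hn2⟩ := (hfr.and_eventually hev).exists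
  have hc : (0 : ℝ) < (F n).card := by exact_mod_cast (hF.1 n).card_pos
  rw [lt_div_iff₀ hc] at hn1
  have hn2' : ∀ w : W, ((((F n).image (φ w + ·)) ∆ (F n)).card : ℝ) < δ / 4 * (F n).card :=
    fun w => (div_lt_iff₀ hc).1 (hn2 w)
  have hcard : Set.ncard (A ∩ ↑(F n)) = ((F n).filter (· ∈ A)).card := by
    rw [← Set.ncard_coe_finset]
    congr 1
    ext x
    simp [and_comm]
  rw [hcard] at hn1
  have hw : ∀ w : W, δ / 4 * (F n).card ≤ ∑ g ∈ F n, ind (g + φ w ∈ A) := by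
    intro w
    have h1 : ∑ g ∈ F n, ind (g + φ w ∈ A) = (((F n).filter (fun g => g + φ w ∈ A)).card : ℝ) := by
      rw [Finset.card_filter]; push_cast
      exact Finset.sum_congr rfl fun g _ => by simp [ind]
    have h2 : (F n).filter (· ∈ A) ⊆
        ((F n).filter (fun g => g + φ w ∈ A)).image (φ w + ·) ∪ (((F n).image (φ w + ·)) ∆ (F n)) := by
      intro x hx
      rw [Finset.mem_filter] at hx
      by_cases hxi : x ∈ (F n).image (φ w + ·)
      · apply Finset.mem_union_left
        obtain ⟨g, hg, rfl⟩ := Finset.mem_image.1 hxi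
        refine Finset.mem_image.2 ⟨g, Finset.mem_filter.2 ⟨hg, ?_⟩, rfl⟩
        rw [add_comm]; exact hx.2
      · apply Finset.mem_union_right
        rw [Finset.mem_symmDiff]
        exact Or.inr ⟨hx.1, hxi⟩
    have h3 := (Finset.card_le_card h2).trans ((Finset.card_union_le _ _).trans
      (Nat.add_le_add_right Finset.card_image_le _))
    have h4 : (((F n).filter (· ∈ A)).card : ℝ) ≤ (((F n).filter (fun g => g + φ w ∈ A)).card : ℝ) +
        ((((F n).image (φ w + ·)) ∆ (F n)).card : ℝ) := by exact_mod_cast h3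
    rw [h1]
    linarith [hn2' w]
  by_contra hcon
  push Not at hcon
  have h5 : av (fun w => ∑ g ∈ F n, ind (g + φ w ∈ A)) =
      ∑ g ∈ F n, av (fun w => ind (g + φ w ∈ A)) := av_sum _ _
  have h6 : δ / 4 * (F n).card ≤ av (fun w => ∑ g ∈ F n, ind (g + φ w ∈ A)) := le_av hw
  have h7 : ∑ g ∈ F n, av (fun w => ind (g + φ w ∈ A)) < ∑ g ∈ F n, δ / 4 :=
    Finset.sum_lt_sum_of_nonempty (hF.1 n) fun g _ => hcon g
  rw [Finset.sum_const, nsmul_eq_mul] at h7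
  linarith

end DHJProof

theorem density_arithmetic_progressions_interval (F : ℕ → Finset ℚ) (hF : IsLeftFolner F)
    (A : Set ℚ) (hA : 0 < upperDensity F A) (k : ℕ) :
    ∃ q : ℚ, q ≠ 0 ∧ Real.exp (-1) - 1 < (q : ℝ) ∧ (q : ℝ) < Real.exp (-1) ∧
      ∃ p ∈ A, ∀ j : ℕ, j ≤ k → p + (j : ℚ) * q ∈ A := by
  classical
  obtain ⟨ι, _, hι⟩ := DHJProof.dhj (Fin (k + 1)) (upperDensity F A / 4) (by positivity)
  cases nonempty_fintype ι
  set h : ℚ := 1 / (3 * ((Fintype.card ι : ℚ) + 1)) with hh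
  have hpos : 0 < h := by positivity
  obtain ⟨g, hg⟩ := DHJProof.exists_shift
    (fun w : ι → Fin (k + 1) => h * ∑ c, ((w c : Fin (k + 1)) : ℚ)) F hF A hA
  obtain ⟨l, hl⟩ := hι {w | g + h * ∑ c, ((w c : Fin (k + 1)) : ℚ) ∈ A} hg
  set m := (Finset.univ.filter fun c => l.idxFun c = none).card with hm
  have hm0 : 0 < m := by
    obtain ⟨c, hc⟩ := l.proper
    exact Finset.card_pos.2 ⟨c, by simp [hc]⟩
  have hm1 : m ≤ Fintype.card ι := Finset.card_le_univ _
  have hq0 : 0 < h * m := mul_pos hpos (by exact_mod_cast hm0)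
  have hq1 : h * m < 1 / 3 := by
    have : (m : ℚ) ≤ Fintype.card ι := by exact_mod_cast hm1
    rw [hh, div_mul_eq_mul_div, div_lt_iff₀ (by positivity)]
    linarith
  have he : (1 : ℝ) / 3 < Real.exp (-1) := by
    rw [Real.exp_neg, one_div]
    exact inv_strictAnti₀ (Real.exp_pos _) (by linarith [Real.exp_one_lt_d9])
  have he1 : Real.exp (-1) < 1 := Real.exp_lt_one_iff.2 (by norm_num)
  have hq0' : (0 : ℝ) < ((h * m : ℚ) : ℝ) := by exact_mod_cast hq0
  have hq1' : ((h * m : ℚ) : ℝ) < 1 / 3 := by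
    have : ((h * m : ℚ) : ℝ) < ((1 / 3 : ℚ) : ℝ) := by exact_mod_cast hq1
    simpa using this
  refine ⟨h * m, hq0.ne', by linarith, by linarith, g + h * ∑ c, ((l 0 c : Fin (k + 1)) : ℚ),
    hl 0, fun j hj => ?_⟩
  have h1 := hl ⟨j, by omega⟩
  have h2 := DHJProof.sum_line l ⟨j, by omega⟩
  have h3 : g + h * ∑ c, ((l ⟨j, by omega⟩ c : Fin (k + 1)) : ℚ) ∈ A := h1
  rw [h2] at h3
  convert h3 using 1
  ring
end
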